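/- Let n, p, r be positive integers with r ≤ p, let h_1,…,h_r be pairwise distinct positive real numbers, let λ_1,…,λ_p be nonnegative real numbers, let Λ = diag(λ_1,…,λ_p), let Π be the p×p diagonal matrix with diagonal entries ((1+h_1)^{−1},…,(1+h_r)^{−1},1,…,1), and let R > max_{1≤s≤p} λ_s. Then ∏_{i=1}^{r}(1+h_i)^{−n} · ∫_{U(p)} exp(−n·tr((Π−I_p) G Λ G⁻¹)) dG = k₁ · det_{1≤i,j≤r}( (1/(2πi)) ∮_{|z|=R} exp(n h_i z/(1+h_i)) · z^{j−1} · ∏_{s=1}^{p}(z−λ_s)^{−1} dz ), where k₁ = (−1)^{r(r−1)/2} · n^{−pr+r(r+1)/2} · ∏_{1≤j<i≤r}(h_i−h_j)^{−1} · ∏_{t=1}^{r}[ h_t^{r−p} (1+h_t)^{p−n−1} (p−t)! ]. -/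

import Mathlib

open MeasureTheory Matrix Real Complex

noncomputable instance (p : ℕ) : MeasurableSpace (Matrix.unitaryGroup (Fin p) ℂ) := borel _

instance (p : ℕ) : BorelSpace (Matrix.unitaryGroup (Fin p) ℂ) := ⟨rfl⟩

instance compactSpace_unitaryGroup (p : ℕ) : CompactSpace (Matrix.unitaryGroup (Fin p) ℂ) := by
  refine isCompact_iff_compactSpace.mp ?_
  have hK : IsCompact (Set.univ.pi fun _ : Fin p => Set.univ.pi fun _ : Fin p =>
      Metric.closedBall (0 : ℂ) 1) :=
    isCompact_univ_pi fun _ => isCompact_univ_pi fun _ => isCompact_closedBall 0 1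
  refine IsCompact.of_isClosed_subset (s := (Set.univ.pi fun _ : Fin p =>
    Set.univ.pi fun _ : Fin p => Metric.closedBall (0 : ℂ) 1)) hK ?_ ?_
  · have : ((Matrix.unitaryGroup (Fin p) ℂ : Submonoid (Matrix (Fin p) (Fin p) ℂ)) :
        Set (Matrix (Fin p) (Fin p) ℂ)) = {A | A * star A = 1} := by
      ext A
      exact Matrix.mem_unitaryGroup_iff
    rw [this]
    exact isClosed_eq (by fun_prop) continuous_const
  · intro A hA i _ j _
    simpa using entry_norm_bound_of_unitary hA i j

section Parametric

variable {G : Type*} [TopologicalSpace G] [CompactSpace G] [MeasurableSpace G] [BorelSpace G]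

theorem Continuous.integrable_of_compactSpace {μ : Measure G} [IsFiniteMeasure μ] {f : G → ℂ}
    (hf : Continuous f) : Integrable f μ :=
  hf.integrable_of_hasCompactSupport (HasCompactSupport.of_compactSpace f)

theorem hasDerivAt_integral_of_continuous_deriv {𝕜 : Type*} [RCLike 𝕜] [NormedSpace 𝕜 ℂ]
    (μ : Measure G) [IsFiniteMeasure μ] {F F' : 𝕜 → G → ℂ}
    (hF : ∀ t, Continuous (F t)) (hF' : Continuous (Function.uncurry F'))
    (hd : ∀ t g, HasDerivAt (fun t => F t g) (F' t g) t) (t₀ : 𝕜) :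
    HasDerivAt (fun t => ∫ g, F t g ∂μ) (∫ g, F' t₀ g ∂μ) t₀ := by
  have hK : IsCompact (Metric.closedBall t₀ 1 ×ˢ (Set.univ : Set G)) :=
    (isCompact_closedBall t₀ 1).prod isCompact_univ
  obtain ⟨C, hC⟩ := hK.exists_bound_of_continuousOn hF'.continuousOn
  refine (hasDerivAt_integral_of_dominated_loc_of_deriv_le (μ := μ) (bound := fun _ => C)
    (Metric.closedBall_mem_nhds t₀ one_pos) (Filter.Eventually.of_forall fun t =>
      (hF t).aestronglyMeasurable) (hF t₀).integrable_of_compactSpace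
    (hF'.comp (Continuous.prodMk_right t₀)).aestronglyMeasurable
    (Filter.Eventually.of_forall fun g t ht => hC (t, g) ⟨ht, Set.mem_univ g⟩)
    (integrable_const C) (Filter.Eventually.of_forall fun g t _ => hd t g)).2

end Parametric

section Loop

variable {p : ℕ}

/-- The conjugate `G B G*` of a matrix by a unitary matrix. -/
def unitaryConj (B : Matrix (Fin p) (Fin p) ℂ) (G : Matrix.unitaryGroup (Fin p) ℂ) :
    Matrix (Fin p) (Fin p) ℂ :=
  (G : Matrix (Fin p) (Fin p) ℂ) * B * (G : Matrix (Fin p) (Fin p) ℂ)ᴴ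

theorem continuous_unitaryConj (B : Matrix (Fin p) (Fin p) ℂ) :
    Continuous (unitaryConj B) := by
  unfold unitaryConj
  have : Continuous fun G : Matrix.unitaryGroup (Fin p) ℂ => (G : Matrix (Fin p) (Fin p) ℂ) :=
    continuous_subtype_val
  fun_prop

attribute [local instance] Matrix.linftyOpNormedRing Matrix.linftyOpNormedAlgebra

theorem exists_unitary_curve (S : Matrix (Fin p) (Fin p) ℂ) (hS : Sᴴ = -S) :
    ∃ U : ℝ → Matrix.unitaryGroup (Fin p) ℂ, Continuous U ∧ U 0 = 1 ∧
      ∀ (B : Matrix (Fin p) (Fin p) ℂ) (G : Matrix.unitaryGroup (Fin p) ℂ) (i j : Fin p) (t : ℝ),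
        HasDerivAt (fun t => unitaryConj B (U t * G) i j)
          ((S * unitaryConj B (U t * G) - unitaryConj B (U t * G) * S) i j) t := by
  have hE : ∀ t : ℝ, (NormedSpace.exp (t • S))ᴴ = NormedSpace.exp (t • (-S)) := by
    intro t
    rw [← Matrix.exp_conjTranspose]
    simp [hS]
  have hmem : ∀ t : ℝ, NormedSpace.exp (t • S) ∈ Matrix.unitaryGroup (Fin p) ℂ := by
    intro t
    rw [Matrix.mem_unitaryGroup_iff, Matrix.star_eq_conjTranspose, hE]
    rw [← Matrix.exp_add_of_commute]
    · simp
    · exact ((Commute.refl S).neg_right.smul_left t).smul_right t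
  have hder : ∀ (T : Matrix (Fin p) (Fin p) ℂ) (t : ℝ), HasDerivAt
      (fun t : ℝ => NormedSpace.exp (t • T)) (T * NormedSpace.exp (t • T)) t :=
    fun T t => hasDerivAt_exp_smul_const' T t
  have hder' : ∀ (T : Matrix (Fin p) (Fin p) ℂ) (t : ℝ), HasDerivAt
      (fun t : ℝ => NormedSpace.exp (t • T)) (NormedSpace.exp (t • T) * T) t :=
    fun T t => hasDerivAt_exp_smul_const T t
  refine ⟨fun t => ⟨_, hmem t⟩, ?_, ?_, ?_⟩
  · exact Continuous.subtype_mk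
      (continuous_iff_continuousAt.mpr fun t => (hder S t).continuousAt) _
  · ext1
    simp
  · intro B G i j t
    have h1 := ((hder S t).mul_const (unitaryConj B G)).mul (hder' (-S) t)
    have h2 := ((Matrix.entryLinearMap ℝ ℂ i j).toContinuousLinearMap.hasFDerivAt).comp_hasDerivAt
      t h1
    have h3 : ∀ t, unitaryConj B (⟨NormedSpace.exp (t • S), hmem t⟩ * G) =
        NormedSpace.exp (t • S) * unitaryConj B G * NormedSpace.exp (t • (-S)) := by
      intro t
      rw [← hE]
      simp [unitaryConj, Matrix.mul_assoc]
    simp only [h3]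
    refine h2.congr_deriv ?_
    change (S * NormedSpace.exp (t • S) * unitaryConj B G * NormedSpace.exp (t • -S) +
      NormedSpace.exp (t • S) * unitaryConj B G * (NormedSpace.exp (t • -S) * -S)) i j = _
    simp [Matrix.mul_assoc, sub_eq_add_neg]

theorem integral_commutator_skew (μ : Measure (Matrix.unitaryGroup (Fin p) ℂ))
    [μ.IsMulLeftInvariant] [IsProbabilityMeasure μ] (B C : Matrix (Fin p) (Fin p) ℂ)
    (a : Fin p → ℂ) (j l : Fin p) (S : Matrix (Fin p) (Fin p) ℂ) (hS : Sᴴ = -S) :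
    ∫ G, ((S * unitaryConj B G - unitaryConj B G * S) j l + unitaryConj B G j l *
      ∑ k, a k * (S * unitaryConj C G - unitaryConj C G * S) k k) *
      Complex.exp (∑ k, a k * unitaryConj C G k k) ∂μ = 0 := by
  obtain ⟨U, hU, hU0, hd⟩ := exists_unitary_curve S hS
  set Φ : Matrix.unitaryGroup (Fin p) ℂ → ℂ := fun G =>
    ((S * unitaryConj B G - unitaryConj B G * S) j l + unitaryConj B G j l *
      ∑ k, a k * (S * unitaryConj C G - unitaryConj C G * S) k k) *
      Complex.exp (∑ k, a k * unitaryConj C G k k) with hΦ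
  set φ : Matrix.unitaryGroup (Fin p) ℂ → ℂ := fun G =>
    unitaryConj B G j l * Complex.exp (∑ k, a k * unitaryConj C G k k) with hφ
  have hB := continuous_unitaryConj B
  have hC := continuous_unitaryConj C
  have hφc : Continuous φ := by fun_prop
  have hΦc : Continuous Φ := by
    have h1 : Continuous fun G => S * unitaryConj B G - unitaryConj B G * S := by fun_prop
    have h2 : Continuous fun G => S * unitaryConj C G - unitaryConj C G * S := by fun_prop
    fun_prop
  have hder := hasDerivAt_integral_of_continuous_deriv μ (F := fun t G => φ (U t * G))
    (F' := fun t G => Φ (U t * G)) (fun t => by fun_prop)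
    (hΦc.comp ((hU.comp continuous_fst).mul continuous_snd)) (fun t G => by
      have h1 := hd B G j l t
      have h2 := (HasDerivAt.fun_sum fun k (_ : k ∈ Finset.univ) =>
        (hd C G k k t).const_mul (a k)).cexp
      refine (h1.mul h2).congr_deriv ?_
      simp only [hΦ]
      ring) 0
  simp only [integral_mul_left_eq_self φ, integral_mul_left_eq_self Φ] at hder
  exact hder.unique (hasDerivAt_const _ _)

theorem integral_commutator (μ : Measure (Matrix.unitaryGroup (Fin p) ℂ))
    [μ.IsMulLeftInvariant] [IsProbabilityMeasure μ] (B C : Matrix (Fin p) (Fin p) ℂ)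
    (a : Fin p → ℂ) (j l : Fin p) (M : Matrix (Fin p) (Fin p) ℂ) :
    ∫ G, ((M * unitaryConj B G - unitaryConj B G * M) j l + unitaryConj B G j l *
      ∑ k, a k * (M * unitaryConj C G - unitaryConj C G * M) k k) *
      Complex.exp (∑ k, a k * unitaryConj C G k k) ∂μ = 0 := by
  set S : Matrix (Fin p) (Fin p) ℂ := (1 / 2 : ℂ) • (M - Mᴴ) with hS
  set T : Matrix (Fin p) (Fin p) ℂ := (-Complex.I / 2 : ℂ) • (M + Mᴴ) with hT
  have hM : M = S + Complex.I • T := by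
    ext x y
    simp only [hS, hT, Matrix.add_apply, Matrix.smul_apply, Matrix.sub_apply, smul_eq_mul]
    linear_combination ((M x y + Mᴴ x y) / 2) * Complex.I_sq
  have hS' : Sᴴ = -S := by
    simp [hS, Matrix.conjTranspose_smul, ← smul_neg]
  have hT' : Tᴴ = -T := by
    ext x y
    simp [hT]
    ring
  have h1 := integral_commutator_skew μ B C a j l S hS'
  have h2 := integral_commutator_skew μ B C a j l T hT'
  have hB := continuous_unitaryConj B
  have hC := continuous_unitaryConj C
  have hintegral : ∀ S : Matrix (Fin p) (Fin p) ℂ, Integrable (fun G =>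
      ((S * unitaryConj B G - unitaryConj B G * S) j l + unitaryConj B G j l *
      ∑ k, a k * (S * unitaryConj C G - unitaryConj C G * S) k k) *
      Complex.exp (∑ k, a k * unitaryConj C G k k)) μ := by
    intro S
    apply Continuous.integrable_of_compactSpace
    have h1 : Continuous fun G => S * unitaryConj B G - unitaryConj B G * S := by fun_prop
    have h2 : Continuous fun G => S * unitaryConj C G - unitaryConj C G * S := by fun_prop
    fun_prop
  have h3 := integral_add (hintegral S) ((hintegral T).const_mul Complex.I)
  rw [integral_const_mul, h1, h2] at h3
  rw [mul_zero, add_zero] at h3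
  rw [← h3]
  congr 1
  ext G
  have e : ∀ D : Matrix (Fin p) (Fin p) ℂ, M * D - D * M =
      (S * D - D * S) + Complex.I • (T * D - D * T) := by
    intro D
    rw [hM]
    simp only [add_mul, mul_add, Matrix.smul_mul, Matrix.mul_smul, smul_sub]
    abel
  simp only [e, Matrix.add_apply, Matrix.smul_apply, smul_eq_mul, mul_add, Finset.sum_add_distrib]
  have e2 : ∑ k, a k * (Complex.I * (T * unitaryConj C G - unitaryConj C G * T) k k) =
      Complex.I * ∑ k, a k * (T * unitaryConj C G - unitaryConj C G * T) k k := by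
    rw [Finset.mul_sum]
    exact Finset.sum_congr rfl fun k _ => by ring
  rw [e2]
  ring

/-- Schwinger–Dyson equation for Haar measure on the unitary group. -/
theorem integral_loop (μ : Measure (Matrix.unitaryGroup (Fin p) ℂ))
    [μ.IsMulLeftInvariant] [IsProbabilityMeasure μ] (B C : Matrix (Fin p) (Fin p) ℂ)
    (a : Fin p → ℂ) {j l : Fin p} (hjl : j ≠ l) :
    (a j - a l) * ∫ G, unitaryConj B G j l * unitaryConj C G l j *
      Complex.exp (∑ k, a k * unitaryConj C G k k) ∂μ =
    ∫ G, (unitaryConj B G j j - unitaryConj B G l l) *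
      Complex.exp (∑ k, a k * unitaryConj C G k k) ∂μ := by
  have h := integral_commutator μ B C a j l (Matrix.single j l (1 : ℂ))
  have hB := continuous_unitaryConj B
  have hC := continuous_unitaryConj C
  rw [← integral_const_mul]
  have e : ∀ G, ((Matrix.single j l (1 : ℂ) * unitaryConj B G - unitaryConj B G * Matrix.single j l (1 : ℂ)) j l
      + unitaryConj B G j l * ∑ k, a k * (Matrix.single j l (1 : ℂ) * unitaryConj C G -
        unitaryConj C G * Matrix.single j l (1 : ℂ)) k k) *
      Complex.exp (∑ k, a k * unitaryConj C G k k) =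
      (a j - a l) * (unitaryConj B G j l * unitaryConj C G l j *
      Complex.exp (∑ k, a k * unitaryConj C G k k)) -
      (unitaryConj B G j j - unitaryConj B G l l) *
      Complex.exp (∑ k, a k * unitaryConj C G k k) := by
    intro G
    have e1 : ∀ D : Matrix (Fin p) (Fin p) ℂ, ∑ k, a k * (Matrix.single j l (1 : ℂ) * D -
        D * Matrix.single j l (1 : ℂ)) k k = (a j - a l) * D l j := by
      intro D
      have : ∀ k, a k * (Matrix.single j l (1 : ℂ) * D - D * Matrix.single j l (1 : ℂ)) k k =
          (if k = j then a j * D l j else 0) - (if k = l then a l * D l j else 0) := by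
        intro k
        rw [Matrix.sub_apply, mul_sub]
        congr 1
        · split_ifs with hk
          · subst hk; simp
          · rw [Matrix.single_mul_apply_of_ne _ _ _ _ _ hk]; simp
        · split_ifs with hk
          · subst hk; simp
          · rw [Matrix.mul_single_apply_of_ne _ _ _ _ _ hk]; simp
      simp only [this, Finset.sum_sub_distrib, Finset.sum_ite_eq', Finset.mem_univ, if_true]
      ring
    rw [e1]
    rw [Matrix.sub_apply, Matrix.single_mul_apply_same, Matrix.mul_single_apply_same]
    ring
  rw [integral_congr_ae (Filter.Eventually.of_forall e)] at h
  rw [integral_sub] at h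
  · exact sub_eq_zero.mp h
  · apply Continuous.integrable_of_compactSpace
    fun_prop
  · apply Continuous.integrable_of_compactSpace
    fun_prop

end Loop

section Algebra

theorem Finset.prod_add_div_eq {ι F : Type*} [DecidableEq ι] [Field F] (K : Finset ι)
    (a α β : ι → F) (ha : Set.InjOn a K) (z : F) (hz : ∀ k ∈ K, z ≠ a k) :
    ∏ k ∈ K, (β k + α k / (z - a k)) = ∏ k ∈ K, β k +
      ∑ j ∈ K, α j / (z - a j) * ∏ k ∈ K.erase j, (β k + α k / (a j - a k)) := by
  induction K using Finset.induction_on generalizing z with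
  | empty => simp
  | insert m K hm ih =>
    have ha' : Set.InjOn a K := ha.mono (by simp)
    have ham : ∀ k ∈ K, a m ≠ a k := fun k hk h => hm (by
      rwa [ha (by simp) (by simp [hk]) h])
    rw [Finset.prod_insert hm, Finset.prod_insert hm, Finset.sum_insert hm,
      Finset.erase_insert hm, ih ha' z (fun k hk => hz k (by simp [hk])), ih ha' (a m) ham]
    have hsum : ∑ j ∈ K, α j / (z - a j) *
        ∏ k ∈ (insert m K).erase j, (β k + α k / (a j - a k)) =
        ∑ j ∈ K, α j / (z - a j) * ((β m + α m / (a j - a m)) *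
          ∏ k ∈ K.erase j, (β k + α k / (a j - a k))) := by
      refine Finset.sum_congr rfl fun j hj => ?_
      have hjm : m ≠ j := fun h => hm (h ▸ hj)
      rw [Finset.erase_insert_of_ne hjm, Finset.prod_insert (fun h => hm (Finset.mem_of_mem_erase h))]
    rw [hsum]
    have key : (α m / (z - a m)) * ∑ j ∈ K, α j / (z - a j) *
          ∏ k ∈ K.erase j, (β k + α k / (a j - a k)) =
        (α m / (z - a m)) * ∑ j ∈ K, α j / (a m - a j) *
          ∏ k ∈ K.erase j, (β k + α k / (a j - a k)) +
        ∑ j ∈ K, α j / (z - a j) * (α m / (a j - a m) *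
          ∏ k ∈ K.erase j, (β k + α k / (a j - a k))) := by
      rw [Finset.mul_sum, Finset.mul_sum, ← Finset.sum_add_distrib]
      refine Finset.sum_congr rfl fun j hj => ?_
      have h1 : z - a m ≠ 0 := sub_ne_zero.mpr (hz m (by simp))
      have h2 : z - a j ≠ 0 := sub_ne_zero.mpr (hz j (by simp [hj]))
      have h3 : a m - a j ≠ 0 := sub_ne_zero.mpr (ham j hj)
      have h4 : a j - a m ≠ 0 := sub_ne_zero.mpr (ham j hj).symm
      generalize (∏ k ∈ K.erase j, (β k + α k / (a j - a k))) = P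
      have h5 : a j - a m = -(a m - a j) := by ring
      rw [h5]
      field_simp
      ring
    have hsplit : ∑ j ∈ K, α j / (z - a j) * ((β m + α m / (a j - a m)) *
          ∏ k ∈ K.erase j, (β k + α k / (a j - a k))) =
        β m * ∑ j ∈ K, α j / (z - a j) * ∏ k ∈ K.erase j, (β k + α k / (a j - a k)) +
        ∑ j ∈ K, α j / (z - a j) * (α m / (a j - a m) *
          ∏ k ∈ K.erase j, (β k + α k / (a j - a k))) := by
      rw [Finset.mul_sum, ← Finset.sum_add_distrib]
      exact Finset.sum_congr rfl fun j hj => by ring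
    rw [hsplit]
    linear_combination key

theorem Matrix.det_updateRow_eq_sum_single {m R : Type*} [Fintype m] [DecidableEq m] [CommRing R]
    (M : Matrix m m R) (k : m) (v : m → R) :
    (M.updateRow k v).det = ∑ i, v i * (M.updateRow k (Pi.single i 1)).det := by
  have h := (Matrix.cramer Mᵀ).pi_apply_eq_sum_univ v
  have h2 := congrFun h k
  have h3 : ∀ i : m, (fun j => if i = j then (1 : R) else 0) = Pi.single i 1 := fun i => by
    ext j
    simp [Pi.single_apply, eq_comm]
  simpa [Matrix.cramer_transpose_apply, Finset.sum_apply, h3] using h2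

theorem Matrix.det_vandermonde_updateRow_deriv {F : Type*} [Field F] {p : ℕ} (a : Fin p → F)
    (ha : Function.Injective a) (j : Fin p) :
    ((vandermonde a).updateRow j fun m => (m : F) * a j ^ ((m : ℕ) - 1)).det =
      (∑ l ∈ Finset.univ.erase j, (a j - a l)⁻¹) * (vandermonde a).det := by
  set c : Fin p → F := fun i => ((vandermonde a).updateRow j (Pi.single i 1)).det with hc
  set P : Polynomial F := ∑ i : Fin p, Polynomial.C (c i) * Polynomial.X ^ (i : ℕ) with hP
  have hdeg : P.degree < (Finset.univ : Finset (Fin p)).card := by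
    rw [Finset.card_univ, Fintype.card_fin, hP]
    exact Polynomial.degree_sum_fin_lt c
  have heval : ∀ t, P.eval t = ((vandermonde a).updateRow j fun m => t ^ (m : ℕ)).det := by
    intro t
    rw [det_updateRow_eq_sum_single]
    simp only [hP, Polynomial.eval_finsetSum, Polynomial.eval_mul, Polynomial.eval_C,
      Polynomial.eval_pow, Polynomial.eval_X]
    exact Finset.sum_congr rfl fun i _ => mul_comm _ _
  have hself : P.eval (a j) = (vandermonde a).det := by
    rw [heval]
    congr 1
    exact Matrix.updateRow_eq_self _ j
  have hother : ∀ k, k ≠ j → P.eval (a k) = 0 := by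
    intro k hk
    rw [heval]
    refine Matrix.det_zero_of_row_eq hk ?_
    ext m
    simp [Matrix.updateRow_apply, hk, vandermonde_apply]
  have hbasis : P = Polynomial.C (vandermonde a).det * Lagrange.basis Finset.univ a j := by
    rw [Lagrange.eq_interpolate (f := P) ha.injOn hdeg, Lagrange.interpolate_apply,
      Finset.sum_eq_single j]
    · rw [hself]
    · intro k _ hk
      simp [hother k hk]
    · simp
  have hder : (Polynomial.derivative P).eval (a j) =
      ((vandermonde a).updateRow j fun m => (m : F) * a j ^ ((m : ℕ) - 1)).det := by
    rw [det_updateRow_eq_sum_single]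
    simp only [hP, Polynomial.derivative_sum, Polynomial.eval_finsetSum,
      Polynomial.derivative_C_mul_X_pow, Polynomial.eval_mul, Polynomial.eval_C,
      Polynomial.eval_pow, Polynomial.eval_X]
    exact Finset.sum_congr rfl fun i _ => by simp only [hc]; ring
  rw [← hder, hbasis, Polynomial.derivative_C_mul, Polynomial.eval_mul, Polynomial.eval_C, mul_comm]
  congr 1
  rw [Lagrange.basis, Polynomial.derivative_prod_finset, Polynomial.eval_finsetSum]
  refine Finset.sum_congr rfl fun l hl => ?_
  rw [Polynomial.eval_mul, Polynomial.eval_prod, Finset.prod_eq_one, one_mul]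
  · simp [Lagrange.basisDivisor]
  · intro k hk
    exact Lagrange.eval_basisDivisor_left_of_ne fun h =>
      (Finset.ne_of_mem_erase (Finset.mem_of_mem_erase hk)) (ha h).symm

end Algebra

section RowOperator

variable {G : Type*} [TopologicalSpace G] [CompactSpace G] [MeasurableSpace G] [BorelSpace G]

theorem Matrix.of_update_eq_updateRow {m n R : Type*} [DecidableEq m] (w : m → n → R)
    (k : m) (v : n → R) : Matrix.of (Function.update w k v) = (Matrix.of w).updateRow k v := rfl

/-- A first-order operator `λ - d/dt` may be applied to each of the rows in `K` of a vanishing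
averaged determinant. -/
theorem sum_integral_det_rows_sub_deriv_eq_zero {ι : Type*} [Fintype ι] {p : ℕ}
    (μ : Measure G) [IsFiniteMeasure μ] (c : ι → G → ℂ) (hc : ∀ l, Continuous (c l))
    (u u' : ι → Fin p → ℂ → G → Fin p → ℂ) (K : Finset (Fin p))
    (hu : ∀ l k, Continuous (Function.uncurry (u l k)))
    (hu' : ∀ l, ∀ k ∈ K, Continuous (Function.uncurry (u' l k)))
    (hd : ∀ l, ∀ k ∈ K, ∀ g m t, HasDerivAt (fun t => u l k t g m) (u' l k t g m) t)
    (lam : ℂ) (S : Set (Fin p → ℂ))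
    (hS : ∀ a ∈ S, ∀ k ∈ K, ∀ᶠ t in nhds (a k), Function.update a k t ∈ S)
    (h0 : ∀ a ∈ S, ∑ l, ∫ g, c l g * (Matrix.of fun k => u l k (a k) g).det ∂μ = 0) :
    ∀ a ∈ S, ∑ l, ∫ g, c l g * (Matrix.of fun k => if k ∈ K then
      lam • u l k (a k) g - u' l k (a k) g else u l k (a k) g).det ∂μ = 0 := by
  induction K using Finset.induction_on with
  | empty => simpa using h0
  | insert k K hk ih =>
    have ih' := ih (fun l k hk => hu' l k (by simp [hk])) (fun l k hk => hd l k (by simp [hk]))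
      (fun a ha k hk => hS a ha k (by simp [hk]))
    intro a ha
    set w : ι → G → Fin p → Fin p → ℂ := fun l g i => if i ∈ K then
      lam • u l i (a i) g - u' l i (a i) g else u l i (a i) g with hw
    have hwc : ∀ l, Continuous (w l) := by
      intro l
      refine continuous_pi fun i => ?_
      simp only [hw]
      have h1 : Continuous fun g => u l i (a i) g := (hu l i).comp (Continuous.prodMk_right _)
      by_cases hi : i ∈ K
      · have h2 : Continuous fun g => u' l i (a i) g :=
          (hu' l i (by simp [hi])).comp (Continuous.prodMk_right _)
        simp only [hi, if_true]
        exact (h1.const_smul lam).sub h2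
      · simpa only [hi, if_false] using h1
    have hF : ∀ l t, Continuous fun g => c l g * ((Matrix.of (w l g)).updateRow k (u l k t g)).det := by
      intro l t
      have h1 : Continuous fun g => u l k t g := (hu l k).comp (Continuous.prodMk_right _)
      exact (hc l).mul ((hwc l).matrix_updateRow k h1).matrix_det
    have hF' : ∀ l, Continuous (Function.uncurry fun t g =>
        c l g * ((Matrix.of (w l g)).updateRow k (u' l k t g)).det) := by
      intro l
      exact ((hc l).comp continuous_snd).mul
        (((hwc l).comp continuous_snd).matrix_updateRow k (hu' l k (by simp))).matrix_det
    have hder := HasDerivAt.fun_sum (u := Finset.univ) fun l (_ : l ∈ Finset.univ) =>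
      hasDerivAt_integral_of_continuous_deriv μ (hF l) (hF' l) (fun t g => by
        simp only [det_updateRow_eq_sum_single _ k (u l k _ g),
          det_updateRow_eq_sum_single _ k (u' l k _ g)]
        exact (HasDerivAt.fun_sum fun i _ => (hd l k (by simp) g i t).mul_const _).const_mul _) (a k)
    have hrow : ∀ t l g, (Matrix.of fun i => if i ∈ K then
        lam • u l i (Function.update a k t i) g - u' l i (Function.update a k t i) g
        else u l i (Function.update a k t i) g) = (Matrix.of (w l g)).updateRow k (u l k t g) := by
      intro t l g
      rw [← Matrix.of_update_eq_updateRow]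
      congr 1
      ext i : 1
      rcases eq_or_ne i k with rfl | hi
      · simp [hk]
      · simp [hi, hw]
    have hzero : (fun t => ∑ l, ∫ g, c l g * ((Matrix.of (w l g)).updateRow k (u l k t g)).det ∂μ)
        =ᶠ[nhds (a k)] fun _ => 0 := by
      filter_upwards [hS a ha k (by simp)] with t ht
      have := ih' _ ht
      simpa only [hrow] using this
    have hd0 := hder.unique ((hasDerivAt_const (a k) (0 : ℂ)).congr_of_eventuallyEq hzero)
    have h00 := hzero.self_of_nhds
    have hrow' : ∀ l g, (Matrix.of fun i => if i ∈ insert k K then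
        lam • u l i (a i) g - u' l i (a i) g else u l i (a i) g) =
        (Matrix.of (w l g)).updateRow k (lam • u l k (a k) g + (-1 : ℂ) • u' l k (a k) g) := by
      intro l g
      rw [← Matrix.of_update_eq_updateRow]
      congr 1
      ext i : 1
      rcases eq_or_ne i k with rfl | hi
      · simp [sub_eq_add_neg]
      · simp [hi, hw]
    simp only [hrow', det_updateRow_add, det_updateRow_smul]
    have hintegral : ∀ l, ∫ g, c l g * (lam * ((Matrix.of (w l g)).updateRow k (u l k (a k) g)).det +
        -1 * ((Matrix.of (w l g)).updateRow k (u' l k (a k) g)).det) ∂μ =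
        lam * ∫ g, c l g * ((Matrix.of (w l g)).updateRow k (u l k (a k) g)).det ∂μ -
        ∫ g, c l g * ((Matrix.of (w l g)).updateRow k (u' l k (a k) g)).det ∂μ := by
      intro l
      rw [← integral_const_mul, ← integral_sub]
      · congr 1
        ext g
        ring
      · exact (hF l (a k)).integrable_of_compactSpace.const_mul lam
      · exact ((hF' l).comp (Continuous.prodMk_right (a k))).integrable_of_compactSpace
    simp only [hintegral, Finset.sum_sub_distrib, ← Finset.mul_sum, h00, hd0]
    simp

end RowOperator

section LoopDeterminant

/-- The function `t ^ m * exp (t * x)` of `t`. -/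
noncomputable def expMonomial (x t : ℂ) (m : ℕ) : ℂ := t ^ m * Complex.exp (t * x)

/-- The derivative in `t` of `expMonomial x t m`. -/
noncomputable def expMonomialDeriv (x t : ℂ) (m : ℕ) : ℂ :=
  (m * t ^ (m - 1) + x * t ^ m) * Complex.exp (t * x)

theorem hasDerivAt_expMonomial (x t : ℂ) (m : ℕ) :
    HasDerivAt (fun t => expMonomial x t m) (expMonomialDeriv x t m) t := by
  have h := (hasDerivAt_pow m t).mul (((hasDerivAt_id t).mul_const x).cexp)
  refine h.congr_deriv ?_
  simp only [expMonomialDeriv, id]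
  ring

variable {G : Type*} [TopologicalSpace G] [CompactSpace G] [MeasurableSpace G] [BorelSpace G]
  {p : ℕ}

theorem integral_det_rows_sub_deriv_aux (μ : Measure G) [IsProbabilityMeasure μ]
    (x N : Fin p → G → ℂ) (hx : ∀ i, Continuous (x i)) (hNc : ∀ i, Continuous (N i)) (lam : ℂ)
    (j : Fin p) (a : Fin p → ℂ) (ha : Function.Injective a)
    (hloop : ∫ g, N j g * (lam - x j g) * Complex.exp (∑ k, a k * x k g) ∂μ =
      ∑ l ∈ Finset.univ.erase j, (a j - a l)⁻¹ *
        ∫ g, (N j g - N l g) * Complex.exp (∑ k, a k * x k g) ∂μ) :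
    ∑ l, ∫ g, N l g * (Matrix.of fun k => if k = j then
        (if l = j then fun m : Fin p => lam * expMonomial (x k g) (a k) m -
            expMonomialDeriv (x k g) (a k) m
          else fun m : Fin p => expMonomial (x k g) (a k) m)
        else if k = l then fun m : Fin p => expMonomial (x k g) (a k) m
        else fun m : Fin p => (a j - a k) * expMonomial (x k g) (a k) m).det ∂μ = 0 := by
  set M : Fin p → G → Matrix (Fin p) (Fin p) ℂ := fun l g =>
    (Matrix.of fun k => if k = j then
        (if l = j then fun m : Fin p => lam * expMonomial (x k g) (a k) m -
            expMonomialDeriv (x k g) (a k) m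
          else fun m : Fin p => expMonomial (x k g) (a k) m)
        else if k = l then fun m : Fin p => expMonomial (x k g) (a k) m
        else fun m : Fin p => (a j - a k) * expMonomial (x k g) (a k) m) with hM
  change ∑ l, ∫ g, N l g * (M l g).det ∂μ = 0
  set q : Fin p → ℂ := fun k => if k = j then 1 else a j - a k with hq
  have hj : ∀ g, (M j g).det =
      (∏ k, q k) * (vandermonde a).det * ((lam - x j g) * Complex.exp (∑ k, a k * x k g)) -
      (∏ k, q k) * (vandermonde a).det * ∑ l ∈ Finset.univ.erase j, (a j - a l)⁻¹ *
        Complex.exp (∑ k, a k * x k g) := by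
    intro g
    have h1 : (M j g) =
        Matrix.of fun k m => (q k * Complex.exp (a k * x k g)) * ((vandermonde a).updateRow j
          ((lam - x j g) • (vandermonde a) j + (-1 : ℂ) •
            fun m : Fin p => (m : ℂ) * a j ^ ((m : ℕ) - 1))) k m := by
      ext k m
      rcases eq_or_ne k j with rfl | hk
      · simp [hM, hq, vandermonde_apply, expMonomial, expMonomialDeriv]
        ring
      · simp [hM, hq, hk, vandermonde_apply, expMonomial]
        ring
    rw [h1, det_mul_column, det_updateRow_add, det_updateRow_smul, det_updateRow_smul,
      det_vandermonde_updateRow_deriv a ha, updateRow_eq_self, Finset.prod_mul_distrib,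
      ← Complex.exp_sum, ← Finset.sum_mul]
    ring
  have hl : ∀ l ∈ Finset.univ.erase j, ∀ g, (M l g).det =
      (∏ k, q k) * (vandermonde a).det * ((a j - a l)⁻¹ * Complex.exp (∑ k, a k * x k g)) := by
    intro l hl g
    have hlj : l ≠ j := Finset.ne_of_mem_erase hl
    have hne : a j - a l ≠ 0 := sub_ne_zero.mpr fun h => hlj (ha h).symm
    have h1 : (M l g) =
        Matrix.of fun k m => (q k * (if k = l then (a j - a l)⁻¹ else 1) *
          Complex.exp (a k * x k g)) * (vandermonde a) k m := by
      ext k m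
      rcases eq_or_ne k j with rfl | hk
      · simp [hM, hq, vandermonde_apply, expMonomial, hlj, hlj.symm]
        ring
      · rcases eq_or_ne k l with rfl | hk'
        · simp [hM, hq, hk, vandermonde_apply, expMonomial, hne]
          ring
        · simp [hM, hq, hk, hk', vandermonde_apply, expMonomial]
          ring
    rw [h1, det_mul_column, Finset.prod_mul_distrib, Finset.prod_mul_distrib, ← Complex.exp_sum,
      Finset.prod_ite_eq']
    simp only [Finset.mem_univ, if_true]
    ring
  rw [← Finset.add_sum_erase _ _ (Finset.mem_univ j)]
  simp only [hj]
  rw [Finset.sum_congr rfl fun l hl' => integral_congr_ae (Filter.Eventually.of_forall fun g =>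
    congrArg (N l g * ·) (hl l hl' g))]
  set D := (∏ k, q k) * (vandermonde a).det
  have i1 : Integrable (fun g => N j g * (lam - x j g) * Complex.exp (∑ k, a k * x k g)) μ := by
    apply Continuous.integrable_of_compactSpace
    fun_prop
  have i2 : ∀ l, Integrable (fun g => N l g * Complex.exp (∑ k, a k * x k g)) μ := by
    intro l
    apply Continuous.integrable_of_compactSpace
    fun_prop
  have e1 : ∀ g, N j g * (D * ((lam - x j g) * Complex.exp (∑ k, a k * x k g)) -
      D * ∑ l ∈ Finset.univ.erase j, (a j - a l)⁻¹ * Complex.exp (∑ k, a k * x k g)) =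
      D * (N j g * (lam - x j g) * Complex.exp (∑ k, a k * x k g)) -
      (D * ∑ l ∈ Finset.univ.erase j, (a j - a l)⁻¹) *
        (N j g * Complex.exp (∑ k, a k * x k g)) := by
    intro g
    rw [← Finset.sum_mul]
    ring
  have e2 : ∀ l g, N l g * (D * ((a j - a l)⁻¹ * Complex.exp (∑ k, a k * x k g))) =
      (D * (a j - a l)⁻¹) * (N l g * Complex.exp (∑ k, a k * x k g)) := fun l g => by ring
  have e3 : ∀ l, ∫ g, (N j g - N l g) * Complex.exp (∑ k, a k * x k g) ∂μ =
      ∫ g, N j g * Complex.exp (∑ k, a k * x k g) ∂μ -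
      ∫ g, N l g * Complex.exp (∑ k, a k * x k g) ∂μ := by
    intro l
    rw [← integral_sub (i2 j) (i2 l)]
    simp only [sub_mul]
  simp only [e1, e2, integral_const_mul]
  rw [integral_sub (i1.const_mul D) ((i2 j).const_mul _), integral_const_mul, integral_const_mul,
    hloop]
  simp only [e3, mul_sub, Finset.sum_sub_distrib, ← Finset.sum_mul, mul_assoc, ← Finset.mul_sum]
  ring

theorem integral_det_rows_sub_deriv_eq_zero (μ : Measure G) [IsProbabilityMeasure μ]
    (x N : Fin p → G → ℂ) (hx : ∀ i, Continuous (x i)) (hNc : ∀ i, Continuous (N i)) (lam : ℂ)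
    (hN : ∀ g, ∑ l, N l g = 1)
    (hloop : ∀ a : Fin p → ℂ, Function.Injective a → ∀ j,
      ∫ g, N j g * (lam - x j g) * Complex.exp (∑ k, a k * x k g) ∂μ =
      ∑ l ∈ Finset.univ.erase j, (a j - a l)⁻¹ *
        ∫ g, (N j g - N l g) * Complex.exp (∑ k, a k * x k g) ∂μ)
    (a : Fin p → ℂ) (ha : Function.Injective a) :
    ∫ g, (Matrix.of fun i m : Fin p => lam * expMonomial (x i g) (a i) m -
      expMonomialDeriv (x i g) (a i) m).det ∂μ = 0 := by
  set A : Fin p → ℂ → G → Fin p → ℂ := fun k t g m => expMonomial (x k g) t m with hA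
  set A' : Fin p → ℂ → G → Fin p → ℂ := fun k t g m => expMonomialDeriv (x k g) t m with hA'
  have hAc : ∀ k, Continuous (Function.uncurry (A k)) := by
    intro k
    refine continuous_pi fun m => ?_
    simp only [hA, Function.uncurry_def, expMonomial]
    have := hx k
    fun_prop
  have hAc' : ∀ k, Continuous (Function.uncurry (A' k)) := by
    intro k
    refine continuous_pi fun m => ?_
    simp only [hA', Function.uncurry_def, expMonomialDeriv]
    have := hx k
    fun_prop
  set B : Fin p → G → Fin p → ℂ := fun k g => lam • A k (a k) g - A' k (a k) g with hB
  have hj : ∀ j, ∑ l, ∫ g, N l g * (Matrix.of fun k => if k = j then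
      (if l = j then B k g else A k (a k) g) else if k = l then B k g else
      (a j - a k) • B k g + A k (a k) g).det ∂μ = 0 := by
    intro j
    set u : Fin p → Fin p → ℂ → G → Fin p → ℂ := fun l k t g => if k = j then
      (if l = j then lam • A k t g - A' k t g else A k t g) else if k = l then A k t g else
      (a j - t) • A k t g with hu
    set u' : Fin p → Fin p → ℂ → G → Fin p → ℂ := fun l k t g => if k = l then A' k t g else
      (a j - t) • A' k t g - A k t g with hu'
    have h := sum_integral_det_rows_sub_deriv_eq_zero μ N hNc u u' (Finset.univ.erase j)
      (fun l k => by
        have h1 := hAc k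
        have h2 := hAc' k
        simp only [Function.uncurry_def] at h1 h2
        simp only [hu, Function.uncurry_def]
        split_ifs <;> fun_prop)
      (fun l k _ => by
        have h1 := hAc k
        have h2 := hAc' k
        simp only [Function.uncurry_def] at h1 h2
        simp only [hu', Function.uncurry_def]
        split_ifs <;> fun_prop)
      (fun l k hk g m t => by
        have hkj : k ≠ j := Finset.ne_of_mem_erase hk
        have h1 := hasDerivAt_expMonomial (x k g) t m
        simp only [hu, hu', hkj, if_false]
        split_ifs
        · exact h1
        · refine (((hasDerivAt_id t).const_sub (a j)).mul h1).congr_deriv ?_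
          simp only [Pi.sub_apply, Pi.smul_apply, smul_eq_mul, hA, hA', id]
          ring)
      lam {b | Function.Injective b ∧ b j = a j}
      (fun b hb k hk => by
        have hkj : k ≠ j := Finset.ne_of_mem_erase hk
        have hfin : ∀ᶠ t in nhds (b k), ∀ i ∈ Finset.univ.erase k, t ≠ b i :=
          (Finset.eventually_all _).mpr fun i hi =>
            isOpen_ne.mem_nhds fun h => Finset.ne_of_mem_erase hi (hb.1 h).symm
        filter_upwards [hfin] with t ht
        refine ⟨?_, by simpa [hkj.symm] using hb.2⟩
        intro i i' hii
        by_cases h1 : i = k <;> by_cases h2 : i' = k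
        · rw [h1, h2]
        · subst h1
          simp [h2] at hii
          exact absurd hii (ht i' (by simp [h2]))
        · subst h2
          simp [h1] at hii
          exact absurd hii.symm (ht i (by simp [h1]))
        · simp [h1, h2] at hii
          exact hb.1 hii)
      (fun b hb => by
        have := integral_det_rows_sub_deriv_aux μ x N hx hNc lam j b hb.1 (hloop b hb.1 j)
        rw [← this]
        refine Finset.sum_congr rfl fun l _ => integral_congr_ae
          (Filter.Eventually.of_forall fun g => ?_)
        dsimp only
        congr 2
        have hbj : b j = a j := hb.2
        simp only [hu, ← hbj]
        rfl)
      a ⟨ha, rfl⟩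
    rw [← h]
    refine Finset.sum_congr rfl fun l _ => integral_congr_ae
      (Filter.Eventually.of_forall fun g => ?_)
    dsimp only
    congr 2
    simp only [EmbeddingLike.apply_eq_iff_eq]
    ext k m
    by_cases hk : k = j
    · subst hk
      simp [hu, hB]
    · by_cases hkl : k = l
      · subst hkl
        simp [hu, hu', hB, hk]
      · simp [hu, hu', hB, hk, hkl]
        ring
  have hBc : ∀ k, Continuous (B k) := by
    intro k
    exact (((hAc k).comp (Continuous.prodMk_right (a k))).const_smul lam).sub
      ((hAc' k).comp (Continuous.prodMk_right (a k)))
  have hAac : ∀ k, Continuous (A k (a k)) := fun k => (hAc k).comp (Continuous.prodMk_right (a k))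
  set q : Fin p → Fin p → ℂ := fun j k => if k = j then 1 else a j - a k with hq
  have hq0 : ∀ j, ∏ k, q j k ≠ 0 := by
    intro j
    refine Finset.prod_ne_zero_iff.mpr fun k _ => ?_
    simp only [hq]
    split_ifs with hk
    · exact one_ne_zero
    · exact sub_ne_zero.mpr fun h => hk (ha h).symm
  set W : Fin p → Fin p → G → ℂ := fun j l g => (∏ k, q j k)⁻¹ * (Matrix.of fun k => if k = j then
      (if l = j then B k g else A k (a k) g) else if k = l then B k g else
      (a j - a k) • B k g + A k (a k) g).det with hW
  have hWc : ∀ j l, Continuous (W j l) := by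
    intro j l
    have : Continuous fun g k => if k = j then (if l = j then B k g else A k (a k) g) else
        if k = l then B k g else (a j - a k) • B k g + A k (a k) g := by
      refine continuous_pi fun k => ?_
      have h1 := hBc k
      have h2 := hAac k
      split_ifs <;> fun_prop
    exact continuous_const.mul (Continuous.matrix_det this)
  have hWj : ∀ j, ∑ l, ∫ g, N l g * W j l g ∂μ = 0 := by
    intro j
    have := congrArg (fun z => (∏ k, q j k)⁻¹ * z) (hj j)
    simp only [Finset.mul_sum, mul_zero, ← integral_const_mul] at this
    rw [← this]
    refine Finset.sum_congr rfl fun l _ => integral_congr_ae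
      (Filter.Eventually.of_forall fun g => ?_)
    simp only [hW]
    ring
  have hsumW : ∀ l g, ∑ j, W j l g = (Matrix.of fun k => B k g).det := by
    intro l g
    have hdet : ∀ j, W j l g = ∑ σ : Equiv.Perm (Fin p), Equiv.Perm.sign σ •
        ((if l = j then ∏ k ∈ Finset.univ.erase l, (B k g (σ k) + A k (a k) g (σ k) / (a l - a k))
          else -(A j (a j) g (σ j) / (a l - a j) * ∏ k ∈ (Finset.univ.erase l).erase j,
            (B k g (σ k) + A k (a k) g (σ k) / (a j - a k)))) * B l g (σ l)) := by
      intro j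
      simp only [hW]
      rw [← Finset.prod_inv_distrib, ← det_mul_column, ← det_transpose, det_apply]
      refine Finset.sum_congr rfl fun σ _ => ?_
      congr 1
      rw [← Finset.prod_erase_mul _ _ (Finset.mem_univ l)]
      split_ifs with hlj
      · subst hlj
        congr 1
        · refine Finset.prod_congr rfl fun k hk => ?_
          have hkl : k ≠ l := Finset.ne_of_mem_erase hk
          have hne : a l - a k ≠ 0 := sub_ne_zero.mpr fun h => hkl (ha h).symm
          simp [hq, hkl]
          field_simp
        · simp [hq]
      · have hjl : j ≠ l := fun h => hlj h.symm
        have hne : a l - a j ≠ 0 := sub_ne_zero.mpr fun h => hlj (ha h)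
        have hne' : a j - a l ≠ 0 := sub_ne_zero.mpr fun h => hlj (ha h).symm
        rw [← Finset.mul_prod_erase (Finset.univ.erase l) _ (Finset.mem_erase.mpr
          ⟨hjl, Finset.mem_univ j⟩)]
        have e1 : ∏ k ∈ (Finset.univ.erase l).erase j, (Matrix.of fun i m => (q j i)⁻¹ *
            (Matrix.of fun k => if k = j then A k (a k) g else
              if k = l then B k g else (a j - a k) • B k g + A k (a k) g) i m)ᵀ (σ k) k =
            ∏ k ∈ (Finset.univ.erase l).erase j,
              (B k g (σ k) + A k (a k) g (σ k) / (a j - a k)) := by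
          refine Finset.prod_congr rfl fun k hk => ?_
          have hkj : k ≠ j := Finset.ne_of_mem_erase hk
          have hkl : k ≠ l := Finset.ne_of_mem_erase (Finset.mem_of_mem_erase hk)
          have hne : a j - a k ≠ 0 := sub_ne_zero.mpr fun h => hkj (ha h).symm
          simp [hq, hkl, hkj]
          field_simp
        rw [e1]
        have e2 : (a j - a l)⁻¹ = -(a l - a j)⁻¹ := by
          rw [← inv_neg, neg_sub]
        simp [hq, hlj, e2]
        ring
    simp only [hdet]
    rw [Finset.sum_comm, ← det_transpose, det_apply]
    refine Finset.sum_congr rfl fun σ _ => ?_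
    rw [← Finset.smul_sum, ← Finset.sum_mul]
    congr 1
    rw [← Finset.prod_erase_mul _ _ (Finset.mem_univ l)]
    congr 1
    rw [← Finset.add_sum_erase _ _ (Finset.mem_univ l)]
    rw [if_pos rfl, Finset.prod_add_div_eq (Finset.univ.erase l) a (fun k => A k (a k) g (σ k))
      (fun k => B k g (σ k)) ha.injOn (a l) fun k hk h => Finset.ne_of_mem_erase hk (ha h).symm]
    rw [add_assoc, ← Finset.sum_add_distrib, Finset.sum_eq_zero, add_zero]
    · rfl
    · intro j hj
      rw [if_neg (Finset.ne_of_mem_erase hj).symm]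
      ring
  have htotal : ∑ j, ∑ l, ∫ g, N l g * W j l g ∂μ = ∫ g, (Matrix.of fun k => B k g).det ∂μ := by
    rw [Finset.sum_comm]
    have : ∀ l, ∑ j, ∫ g, N l g * W j l g ∂μ = ∫ g, N l g * (Matrix.of fun k => B k g).det ∂μ := by
      intro l
      rw [← integral_finsetSum]
      · simp only [← Finset.mul_sum, hsumW]
      · exact fun j _ => ((hNc l).mul (hWc j l)).integrable_of_compactSpace
    simp only [this]
    rw [← integral_finsetSum]
    · simp only [← Finset.sum_mul, hN, one_mul]
    · intro l _
      exact ((hNc l).mul (Continuous.matrix_det (continuous_pi hBc))).integrable_of_compactSpace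
  simp only [hWj, Finset.sum_const_zero] at htotal
  rw [htotal]
  rfl

end LoopDeterminant

section Resolvent

variable {p : ℕ}

/-- The diagonal entries of `G diag(lam) G*`. -/
def conjDiag (lam : Fin p → ℂ) (i : Fin p) (G : Matrix.unitaryGroup (Fin p) ℂ) : ℂ :=
  unitaryConj (Matrix.diagonal lam) G i i

theorem continuous_conjDiag (lam : Fin p → ℂ) (i : Fin p) : Continuous (conjDiag lam i) := by
  have := continuous_unitaryConj (Matrix.diagonal lam)
  unfold conjDiag
  fun_prop

theorem unitary_conjTranspose_mul (G : Matrix.unitaryGroup (Fin p) ℂ) :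
    (G : Matrix (Fin p) (Fin p) ℂ)ᴴ * (G : Matrix (Fin p) (Fin p) ℂ) = 1 :=
  Matrix.mem_unitaryGroup_iff'.mp G.2

theorem unitaryConj_mul (B C : Matrix (Fin p) (Fin p) ℂ) (G : Matrix.unitaryGroup (Fin p) ℂ) :
    unitaryConj B G * unitaryConj C G = unitaryConj (B * C) G := by
  simp only [unitaryConj, Matrix.mul_assoc]
  rw [← Matrix.mul_assoc (G : Matrix (Fin p) (Fin p) ℂ)ᴴ, unitary_conjTranspose_mul,
    Matrix.one_mul]

theorem trace_unitaryConj (B : Matrix (Fin p) (Fin p) ℂ) (G : Matrix.unitaryGroup (Fin p) ℂ) :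
    (unitaryConj B G).trace = B.trace := by
  rw [unitaryConj, Matrix.trace_mul_comm, ← Matrix.mul_assoc, unitary_conjTranspose_mul,
    Matrix.one_mul]

theorem integral_det_expMonomial_eigenvalue (μ : Measure (Matrix.unitaryGroup (Fin p) ℂ))
    [μ.IsMulLeftInvariant] [IsProbabilityMeasure μ] (lam : Fin p → ℂ) (s : Fin p)
    (a : Fin p → ℂ) (ha : Function.Injective a) :
    ∫ G, (Matrix.of fun i m : Fin p => lam s * expMonomial (conjDiag lam i G) (a i) m -
      expMonomialDeriv (conjDiag lam i G) (a i) m).det ∂μ = 0 := by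
  set B : Matrix (Fin p) (Fin p) ℂ := Matrix.single s s 1 with hB
  have hBc := continuous_unitaryConj B
  have hXc := continuous_unitaryConj (Matrix.diagonal lam)
  refine integral_det_rows_sub_deriv_eq_zero μ (conjDiag lam) (fun l G => unitaryConj B G l l)
    (continuous_conjDiag lam) (fun i => by fun_prop) (lam s) (fun G => ?_) (fun a ha j => ?_) a ha
  · have := trace_unitaryConj B G
    rwa [hB, Matrix.trace_single_eq_same] at this
  · have hmul : ∀ G, unitaryConj B G j j * (lam s - conjDiag lam j G) *
        Complex.exp (∑ k, a k * conjDiag lam k G) = ∑ l ∈ Finset.univ.erase j,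
        unitaryConj B G j l * unitaryConj (Matrix.diagonal lam) G l j *
          Complex.exp (∑ k, a k * conjDiag lam k G) := by
      intro G
      have h1 : unitaryConj B G * unitaryConj (Matrix.diagonal lam) G = lam s • unitaryConj B G := by
        rw [unitaryConj_mul]
        have : B * Matrix.diagonal lam = lam s • B := by
          ext x y
          simp only [hB, Matrix.mul_diagonal, Matrix.smul_apply, Matrix.single_apply, smul_eq_mul]
          split_ifs with h
          · rw [← h.2]; ring
          · ring
        rw [this]
        simp [unitaryConj]
      have h2 := congrFun (congrFun h1 j) j
      rw [Matrix.mul_apply, ← Finset.add_sum_erase _ _ (Finset.mem_univ j), Matrix.smul_apply,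
        smul_eq_mul] at h2
      rw [← Finset.sum_mul]
      congr 1
      simp only [conjDiag]
      linear_combination -h2
    rw [integral_congr_ae (Filter.Eventually.of_forall hmul), integral_finsetSum]
    · refine Finset.sum_congr rfl fun l hl => ?_
      have hne : a j - a l ≠ 0 := sub_ne_zero.mpr fun h => Finset.ne_of_mem_erase hl (ha h).symm
      rw [eq_inv_mul_iff_mul_eq₀ hne]
      exact integral_loop μ B (Matrix.diagonal lam) a (Finset.ne_of_mem_erase hl).symm
    · intro l _
      apply Continuous.integrable_of_compactSpace
      have := continuous_conjDiag lam
      fun_prop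

theorem Matrix.det_smul_sub_eq_prod_mul_det_add_sum {F : Type*} [Field F] (A B : Matrix (Fin p) (Fin p) F)
    (lam : Fin p → F) (hlam : Function.Injective lam) (w : F) :
    (w • A - B).det = (∏ s, (w - lam s)) * A.det +
      ∑ s, (lam s • A - B).det * (Lagrange.basis Finset.univ lam s).eval w := by
  set Q : Polynomial F := ((Polynomial.X : Polynomial F) • A.map Polynomial.C +
    (-B).map Polynomial.C).det with hQ
  have heval : ∀ t, Q.eval t = (t • A - B).det := by
    intro t
    rw [hQ, ← Polynomial.coe_evalRingHom, RingHom.map_det]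
    congr 1
    ext i j
    simp [sub_eq_add_neg]
    ring
  set P : Polynomial F := Q - Polynomial.C A.det * ∏ s, (Polynomial.X - Polynomial.C (lam s))
    with hP
  have hmonic : (∏ s : Fin p, (Polynomial.X - Polynomial.C (lam s))).Monic :=
    Polynomial.monic_prod_of_monic _ _ fun s _ => Polynomial.monic_X_sub_C _
  have hndeg : (∏ s : Fin p, (Polynomial.X - Polynomial.C (lam s))).natDegree = p := by
    rw [Polynomial.natDegree_prod_of_monic _ _ fun s _ => Polynomial.monic_X_sub_C _]
    simp
  have hdegQ : Q.natDegree ≤ p := by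
    simpa using Polynomial.natDegree_det_X_add_C_le A (-B)
  have hcoefQ : Q.coeff p = A.det := by
    simpa using Polynomial.coeff_det_X_add_C_card A (-B)
  have hdeg : P.degree < (Finset.univ : Finset (Fin p)).card := by
    rw [Finset.card_univ, Fintype.card_fin, Polynomial.degree_lt_iff_coeff_zero]
    intro m hm
    rw [hP, Polynomial.coeff_sub, Polynomial.coeff_C_mul]
    rcases hm.eq_or_lt with rfl | hm
    · have : (∏ s : Fin p, (Polynomial.X - Polynomial.C (lam s))).coeff p = 1 := by
        have := hmonic.coeff_natDegree
        rwa [hndeg] at this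
      rw [hcoefQ, this]
      ring
    · rw [Polynomial.coeff_eq_zero_of_natDegree_lt (hdegQ.trans_lt hm),
        Polynomial.coeff_eq_zero_of_natDegree_lt (hndeg.trans_lt hm)]
      ring
  have hnode : ∀ s, P.eval (lam s) = (lam s • A - B).det := by
    intro s
    rw [hP, Polynomial.eval_sub, Polynomial.eval_mul, Polynomial.eval_prod, heval,
      Finset.prod_eq_zero (Finset.mem_univ s) (by simp)]
    ring
  have h := congrArg (Polynomial.eval w) (Lagrange.eq_interpolate (f := P) hlam.injOn hdeg)
  rw [Lagrange.interpolate_apply, Polynomial.eval_finsetSum] at h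
  simp only [Polynomial.eval_mul, Polynomial.eval_C, hnode] at h
  rw [← h, hP, Polynomial.eval_sub, heval, Polynomial.eval_mul, Polynomial.eval_prod]
  simp
  ring

theorem eventually_injective_add_mul (v : Fin p → ℂ) :
    ∀ᶠ ε : ℂ in nhdsWithin 0 {0}ᶜ, Function.Injective fun i : Fin p => v i + ε * (i : ℕ) := by
  have : ∀ i j : Fin p, i ≠ j → ∀ᶠ ε : ℂ in nhdsWithin 0 {0}ᶜ,
      v i + ε * (i : ℕ) ≠ v j + ε * (j : ℕ) := by
    intro i j hij
    have hne : ((i : ℕ) : ℂ) - (j : ℕ) ≠ 0 := by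
      rw [sub_ne_zero]
      exact fun h => hij (Fin.ext (by exact_mod_cast h))
    by_cases hv : v i = v j
    · filter_upwards [self_mem_nhdsWithin] with ε hε h
      have : ε * (((i : ℕ) : ℂ) - (j : ℕ)) = 0 := by
        rw [hv] at h
        linear_combination h
      exact (mul_ne_zero hε hne) this
    · refine Filter.Eventually.filter_mono nhdsWithin_le_nhds ?_
      have hc : ContinuousAt (fun ε : ℂ => v i + ε * (i : ℕ) - (v j + ε * (j : ℕ))) 0 := by
        fun_prop
      filter_upwards [hc.eventually_ne (y := 0) (by simpa [sub_eq_zero] using hv)] with ε hε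
      exact sub_ne_zero.mp hε
  have h2 : ∀ᶠ ε : ℂ in nhdsWithin 0 {0}ᶜ, ∀ i j : Fin p, i ≠ j →
      v i + ε * (i : ℕ) ≠ v j + ε * (j : ℕ) := by
    simp only [Filter.eventually_all]
    exact this
  filter_upwards [h2] with ε hε i j h
  by_contra hij
  exact hε i j hij h

theorem continuous_integral_of_continuous_uncurry {X G : Type*} [TopologicalSpace X]
    [FirstCountableTopology X] [LocallyCompactSpace X] [TopologicalSpace G] [CompactSpace G]
    [MeasurableSpace G] [BorelSpace G] (μ : Measure G) [IsFiniteMeasure μ] {F : X → G → ℂ}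
    (hF : Continuous (Function.uncurry F)) : Continuous fun t => ∫ g, F t g ∂μ := by
  have := continuous_parametric_integral_of_continuous (μ := μ) hF isCompact_univ
  simpa using this

/-- The averaged determinants of the rows `w α - α'` and `α`, where `α m = a ^ m exp (a x)`, differ
by the characteristic polynomial. -/
theorem integral_det_expMonomial (μ : Measure (Matrix.unitaryGroup (Fin p) ℂ))
    [μ.IsMulLeftInvariant] [IsProbabilityMeasure μ] (lam a : Fin p → ℂ) (w : ℂ) :
    ∫ G, (Matrix.of fun i m : Fin p => w * expMonomial (conjDiag lam i G) (a i) m -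
      expMonomialDeriv (conjDiag lam i G) (a i) m).det ∂μ =
    (∏ s, (w - lam s)) * ∫ G, (Matrix.of fun i m : Fin p =>
      expMonomial (conjDiag lam i G) (a i) m).det ∂μ := by
  have hinj : ∀ lam a : Fin p → ℂ, Function.Injective lam → Function.Injective a →
      ∫ G, (Matrix.of fun i m : Fin p => w * expMonomial (conjDiag lam i G) (a i) m -
      expMonomialDeriv (conjDiag lam i G) (a i) m).det ∂μ =
      (∏ s, (w - lam s)) * ∫ G, (Matrix.of fun i m : Fin p =>
      expMonomial (conjDiag lam i G) (a i) m).det ∂μ := by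
    intro lam a hlam ha
    set A : Matrix.unitaryGroup (Fin p) ℂ → Matrix (Fin p) (Fin p) ℂ := fun G =>
      Matrix.of fun i m : Fin p => expMonomial (conjDiag lam i G) (a i) m with hA
    set B : Matrix.unitaryGroup (Fin p) ℂ → Matrix (Fin p) (Fin p) ℂ := fun G =>
      Matrix.of fun i m : Fin p => expMonomialDeriv (conjDiag lam i G) (a i) m with hB
    have hcd := continuous_conjDiag lam
    have hAc : Continuous A := by
      refine continuous_matrix fun i m => ?_
      simp only [hA, Matrix.of_apply, expMonomial]
      fun_prop
    have hBc : Continuous B := by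
      refine continuous_matrix fun i m => ?_
      simp only [hB, Matrix.of_apply, expMonomialDeriv]
      fun_prop
    have h0 : ∀ s, ∫ G, (lam s • A G - B G).det ∂μ = 0 := fun s =>
      integral_det_expMonomial_eigenvalue μ lam s a ha
    have hcont : ∀ t : ℂ, Continuous fun G => (t • A G - B G).det := fun t =>
      ((hAc.const_smul t).sub hBc).matrix_det
    change ∫ G, (w • A G - B G).det ∂μ = _ * ∫ G, (A G).det ∂μ
    simp only [fun G => det_smul_sub_eq_prod_mul_det_add_sum (A G) (B G) lam hlam w]
    rw [integral_add, integral_const_mul, integral_finsetSum]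
    · simp [integral_mul_const, h0]
    · exact fun s _ => (hcont (lam s)).integrable_of_compactSpace.mul_const _
    · exact hAc.matrix_det.integrable_of_compactSpace.const_mul _
    · exact integrable_finsetSum _ fun s _ =>
        (hcont (lam s)).integrable_of_compactSpace.mul_const _
  set L : ℂ → Fin p → ℂ := fun ε i => lam i + ε * (i : ℕ) with hL
  set T : ℂ → Fin p → ℂ := fun ε i => a i + ε * (i : ℕ) with hT
  have hX : ∀ i, Continuous fun q : ℂ × Matrix.unitaryGroup (Fin p) ℂ =>
      conjDiag (L q.1) i q.2 := by
    intro i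
    have h1 : Continuous fun q : ℂ × Matrix.unitaryGroup (Fin p) ℂ =>
        (q.2 : Matrix (Fin p) (Fin p) ℂ) := continuous_subtype_val.comp continuous_snd
    have h2 : Continuous fun q : ℂ × Matrix.unitaryGroup (Fin p) ℂ =>
        Matrix.diagonal (L q.1) := by
      refine Continuous.matrix_diagonal (continuous_pi fun i => ?_)
      simp only [hL]
      fun_prop
    have h3 : Continuous fun q : ℂ × Matrix.unitaryGroup (Fin p) ℂ =>
        (q.2 : Matrix (Fin p) (Fin p) ℂ) * Matrix.diagonal (L q.1) *
          (q.2 : Matrix (Fin p) (Fin p) ℂ)ᴴ := by fun_prop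
    exact h3.matrix_elem i i
  have hc1 : Continuous fun ε => ∫ G, (Matrix.of fun i m : Fin p =>
      w * expMonomial (conjDiag (L ε) i G) (T ε i) m -
      expMonomialDeriv (conjDiag (L ε) i G) (T ε i) m).det ∂μ := by
    apply continuous_integral_of_continuous_uncurry
    refine Continuous.matrix_det (continuous_matrix fun i m => ?_)
    have := hX i
    simp only [Matrix.of_apply, hT, expMonomial, expMonomialDeriv]
    fun_prop
  have hc2 : Continuous fun ε => (∏ s, (w - L ε s)) * ∫ G, (Matrix.of fun i m : Fin p =>
      expMonomial (conjDiag (L ε) i G) (T ε i) m).det ∂μ := by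
    refine Continuous.mul ?_ ?_
    · simp only [hL]
      fun_prop
    · apply continuous_integral_of_continuous_uncurry
      refine Continuous.matrix_det (continuous_matrix fun i m => ?_)
      have := hX i
      simp only [Matrix.of_apply, hT, expMonomial]
      fun_prop
  have hlim := tendsto_nhds_unique_of_eventuallyEq
    ((hc1.tendsto 0).mono_left (nhdsWithin_le_nhds (s := {0}ᶜ)))
    ((hc2.tendsto 0).mono_left nhdsWithin_le_nhds) (by
      filter_upwards [eventually_injective_add_mul lam, eventually_injective_add_mul a]
        with ε h1 h2
      exact hinj (L ε) (T ε) h1 h2)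
  simpa [hL, hT] using hlim

end Resolvent

section Transform

theorem integral_pi_integral_det {m : ℕ} {G : Type*} [TopologicalSpace G] [CompactSpace G]
    [MeasurableSpace G] [BorelSpace G] (μ : Measure G) [IsFiniteMeasure μ]
    (ν : Measure ℝ) [SigmaFinite ν] (f : Fin m → Fin m → ℝ → G → ℂ)
    (hf : ∀ i j, Continuous (Function.uncurry (f i j)))
    (hb : ∀ i j, ∃ b : ℝ → ℝ, Integrable b ν ∧ ∀ᵐ t ∂ν, ∀ g, ‖f i j t g‖ ≤ b t) :
    ∫ t : Fin m → ℝ, (∫ g, (Matrix.of fun i j => f i j (t i) g).det ∂μ)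
        ∂(Measure.pi fun _ => ν) =
      ∫ g, (Matrix.of fun i j => ∫ t, f i j t g ∂ν).det ∂μ := by
  choose b hbi hb using hb
  have key : ∀ σ : Equiv.Perm (Fin m), Integrable
      (fun q : (Fin m → ℝ) × G => ∏ i, f i (σ i) (q.1 i) q.2)
      ((Measure.pi fun _ => ν).prod μ) := by
    intro σ
    have hcont : Continuous fun q : (Fin m → ℝ) × G => ∏ i, f i (σ i) (q.1 i) q.2 := by
      refine continuous_finsetProd _ fun i _ => ?_
      have hpair : Continuous fun q : (Fin m → ℝ) × G => (q.1 i, q.2) := by fun_prop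
      exact (hf i (σ i)).comp hpair
    have hI : Integrable (fun t : Fin m → ℝ => ∏ i, b i (σ i) (t i)) (Measure.pi fun _ => ν) :=
      Integrable.fintype_prod (f := fun i => b i (σ i)) (fun i => hbi i (σ i))
    refine (hI.comp_fst μ).mono' hcont.aestronglyMeasurable ?_
    have h1 : ∀ᵐ t ∂(Measure.pi fun _ : Fin m => ν), ∀ i, ∀ g, ‖f i (σ i) (t i) g‖ ≤ b i (σ i) (t i) :=
      Filter.eventually_all.2 fun i =>
        (Measure.tendsto_eval_ae_ae (μ := fun _ : Fin m => ν) (i := i)).eventually (hb i (σ i))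
    have h2 := Measure.quasiMeasurePreserving_fst (μ := Measure.pi fun _ : Fin m => ν) (ν := μ)
      |>.ae h1
    filter_upwards [h2] with q hq
    rw [norm_prod]
    exact Finset.prod_le_prod (fun _ _ => norm_nonneg _) fun i _ => hq i q.2
  have hdet : ∀ M : Matrix (Fin m) (Fin m) ℂ,
      M.det = ∑ σ : Equiv.Perm (Fin m), (Equiv.Perm.sign σ : ℂ) * ∏ i, M i (σ i) := by
    intro M
    rw [← Matrix.det_transpose, Matrix.det_apply']
    rfl
  simp only [hdet, Matrix.of_apply]
  have hkc : ∀ σ : Equiv.Perm (Fin m), ∀ t : Fin m → ℝ,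
      Continuous fun g => ∏ i, f i (σ i) (t i) g := fun σ t =>
    continuous_finsetProd _ fun i _ =>
      (hf i (σ i)).comp ((continuous_const (y := t i)).prodMk continuous_id)
  calc _ = ∫ t : Fin m → ℝ, (∑ σ : Equiv.Perm (Fin m), (Equiv.Perm.sign σ : ℂ) *
          ∫ g, ∏ i, f i (σ i) (t i) g ∂μ) ∂(Measure.pi fun _ => ν) := by
        congr 1; funext t
        rw [integral_finsetSum _ fun σ _ =>
          ((hkc σ t).integrable_of_compactSpace).const_mul _]
        simp only [integral_const_mul]
    _ = ∑ σ : Equiv.Perm (Fin m), (Equiv.Perm.sign σ : ℂ) *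
          ∫ g, ∏ i, ∫ t, f i (σ i) t g ∂ν ∂μ := by
        rw [integral_finsetSum _ fun σ _ => ((key σ).integral_prod_left).const_mul _]
        refine Finset.sum_congr rfl fun σ _ => ?_
        rw [integral_const_mul, integral_integral_swap (key σ)]
        congr 2; funext g
        exact integral_fintype_prod_eq_prod (fun i t => f i (σ i) t g)
    _ = _ := by
        rw [integral_finsetSum]
        · simp only [integral_const_mul]
        · intro σ _
          refine Integrable.const_mul ?_ _
          have := (key σ).integral_prod_right
          refine this.congr (Filter.Eventually.of_forall fun g => ?_)
          exact integral_fintype_prod_eq_prod (fun i t => f i (σ i) t g)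

end Transform

section Laplace

/-- The Laplace transform of `t ↦ t ^ k`, evaluated at `u`. -/
noncomputable def poleTerm (k : ℕ) (u : ℂ) : ℂ := (k.factorial : ℂ) * (u ^ (k + 1))⁻¹

theorem integrableOn_pow_mul_exp_neg_mul {δ : ℝ} (hδ : 0 < δ) (k : ℕ) :
    IntegrableOn (fun t : ℝ => t ^ k * Real.exp (-(δ * t))) (Set.Ioi 0) := by
  have h := integrableOn_rpow_mul_exp_neg_mul_rpow (p := 1) (s := k) (b := δ)
    (lt_of_lt_of_le (by norm_num) (Nat.cast_nonneg k)) one_pos hδ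
  refine h.congr_fun (fun t _ => ?_) measurableSet_Ioi
  simp [Real.rpow_natCast]

theorem norm_pow_mul_exp_neg_mul_le {δ : ℝ} {s : ℂ} (hs : δ ≤ s.re) (k : ℕ) {t : ℝ}
    (ht : 0 ≤ t) : ‖(t : ℂ) ^ k * cexp (-(s * t))‖ ≤ t ^ k * Real.exp (-(δ * t)) := by
  rw [norm_mul, norm_pow, Complex.norm_real, Real.norm_of_nonneg ht, Complex.norm_exp]
  gcongr
  simp
  gcongr

theorem integrableOn_pow_mul_cexp_neg_mul {s : ℂ} (hs : 0 < s.re) (k : ℕ) :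
    IntegrableOn (fun t : ℝ => (t : ℂ) ^ k * cexp (-(s * t))) (Set.Ioi 0) := by
  refine (integrableOn_pow_mul_exp_neg_mul hs k).mono' (by fun_prop) ?_
  filter_upwards [ae_restrict_mem measurableSet_Ioi] with t ht
  exact norm_pow_mul_exp_neg_mul_le le_rfl k (le_of_lt ht)

theorem integral_Ioi_pow_mul_exp_neg_mul {s : ℂ} (hs : 0 < s.re) (k : ℕ) :
    ∫ t : ℝ in Set.Ioi 0, (t : ℂ) ^ k * cexp (-(s * t)) = poleTerm k s := by
  have hs0 : s ≠ 0 := by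
    rintro rfl
    simp at hs
  induction k with
  | zero =>
    have h := integral_exp_mul_complex_Ioi (a := -s) (by simpa using hs) 0
    simp only [neg_mul] at h
    simp [poleTerm, h]
  | succ k ih =>
    have hd : ∀ t : ℝ, HasDerivAt (fun t : ℝ => (t : ℂ) ^ (k + 1) * cexp (-(s * t)))
        (((k + 1 : ℕ) : ℂ) * ((t : ℂ) ^ k * cexp (-(s * t))) -
          s * ((t : ℂ) ^ (k + 1) * cexp (-(s * t)))) t := by
      intro t
      have h1 : HasDerivAt (fun t : ℂ => t ^ (k + 1) * cexp (-(s * t)))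
          (((k + 1 : ℕ) : ℂ) * ((t : ℂ) ^ k * cexp (-(s * t))) -
            s * ((t : ℂ) ^ (k + 1) * cexp (-(s * t)))) (t : ℂ) := by
        have h2 := (hasDerivAt_pow (k + 1) (t : ℂ)).mul
          (((hasDerivAt_id (t : ℂ)).const_mul s).neg.cexp)
        refine h2.congr_deriv ?_
        simp only [Nat.add_sub_cancel, id, mul_one, Pi.neg_apply]
        ring
      exact h1.comp_ofReal
    have hi := integrableOn_pow_mul_cexp_neg_mul hs (k + 1)
    have hi' := ((integrableOn_pow_mul_cexp_neg_mul hs k).const_mul ((k + 1 : ℕ) : ℂ)).sub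
      (hi.const_mul s)
    have hlim := tendsto_zero_of_hasDerivAt_of_integrableOn_Ioi (fun t _ => hd t) hi' hi
    have hmain := integral_Ioi_of_hasDerivAt_of_tendsto' (fun t _ => hd t) hi' hlim
    rw [integral_sub ((integrableOn_pow_mul_cexp_neg_mul hs k).const_mul _) (hi.const_mul s),
      integral_const_mul, integral_const_mul, ih] at hmain
    simp only [poleTerm, Nat.factorial_succ] at hmain ⊢
    simp only [ofReal_zero, ne_eq, Nat.add_eq_zero_iff, one_ne_zero, and_false, not_false_eq_true,
      zero_pow, zero_mul, sub_zero] at hmain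
    apply mul_left_cancel₀ hs0
    rw [← sub_eq_zero.1 hmain]
    push_cast
    field_simp
    ring

/-- The weight turning `expMonomial` into `poleTerm` under integration over `(0, ∞)`. -/
noncomputable def laplaceWeight (y : ℂ) (t : ℝ) : ℂ :=
  (starRingEnd ℂ) y * cexp (-(t * ((starRingEnd ℂ) y * y)))

theorem laplaceWeight_mul_expMonomial (x y : ℂ) (k : ℕ) (t : ℝ) :
    laplaceWeight y t * expMonomial x (t * (starRingEnd ℂ) y) k =
      (starRingEnd ℂ) y ^ (k + 1) * ((t : ℂ) ^ k * cexp (-((starRingEnd ℂ) y * (y - x) * t))) := by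
  rw [laplaceWeight, expMonomial, show -((starRingEnd ℂ) y * (y - x) * t) =
    -(t * ((starRingEnd ℂ) y * y)) + t * (starRingEnd ℂ) y * x by ring, Complex.exp_add]
  ring

theorem expMonomialDeriv_eq (x t : ℂ) (k : ℕ) :
    expMonomialDeriv x t k = k * expMonomial x t (k - 1) + x * expMonomial x t k := by
  rw [expMonomialDeriv, expMonomial, expMonomial]
  ring

theorem mul_sub_le_re_conj_mul_sub {x y : ℂ} {ρ : ℝ} (hx : ‖x‖ ≤ ρ) :
    ‖y‖ * (‖y‖ - ρ) ≤ ((starRingEnd ℂ) y * (y - x)).re := by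
  have h1 : ((starRingEnd ℂ) y * (y - x)).re = ‖y‖ ^ 2 - ((starRingEnd ℂ) y * x).re := by
    rw [mul_sub, Complex.sub_re, Complex.conj_mul', ← Complex.ofReal_pow, Complex.ofReal_re]
  have h2 : ((starRingEnd ℂ) y * x).re ≤ ‖y‖ * ‖x‖ := by
    refine (Complex.re_le_norm _).trans ?_
    rw [norm_mul, RCLike.norm_conj]
  have h3 : ‖y‖ * ‖x‖ ≤ ‖y‖ * ρ := by gcongr
  rw [h1]
  nlinarith

variable {x y : ℂ}

theorem re_conj_mul_sub_pos (hxy : ‖x‖ < ‖y‖) : 0 < ((starRingEnd ℂ) y * (y - x)).re :=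
  lt_of_lt_of_le (mul_pos ((norm_nonneg x).trans_lt hxy) (sub_pos.2 hxy))
    (mul_sub_le_re_conj_mul_sub le_rfl)

theorem integrableOn_laplaceWeight_mul_expMonomial (hxy : ‖x‖ < ‖y‖) (k : ℕ) :
    IntegrableOn (fun t : ℝ => laplaceWeight y t * expMonomial x (t * (starRingEnd ℂ) y) k)
      (Set.Ioi 0) := by
  simp only [laplaceWeight_mul_expMonomial]
  exact (integrableOn_pow_mul_cexp_neg_mul (re_conj_mul_sub_pos hxy) k).const_mul _

theorem integral_laplaceWeight_mul_expMonomial (hxy : ‖x‖ < ‖y‖) (k : ℕ) :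
    ∫ t : ℝ in Set.Ioi 0, laplaceWeight y t * expMonomial x (t * (starRingEnd ℂ) y) k =
      poleTerm k (y - x) := by
  have hy : (starRingEnd ℂ) y ≠ 0 := by
    rw [ne_eq, map_eq_zero]
    rintro rfl
    exact absurd hxy (by simp)
  simp only [laplaceWeight_mul_expMonomial]
  rw [integral_const_mul, integral_Ioi_pow_mul_exp_neg_mul (re_conj_mul_sub_pos hxy), poleTerm,
    poleTerm, mul_pow, mul_inv]
  field_simp

theorem integral_laplaceWeight_mul_sub (hxy : ‖x‖ < ‖y‖) (w : ℂ) (k : ℕ) :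
    ∫ t : ℝ in Set.Ioi 0, laplaceWeight y t * (w * expMonomial x (t * (starRingEnd ℂ) y) k -
        expMonomialDeriv x (t * (starRingEnd ℂ) y) k) =
      (w - y) * poleTerm k (y - x) + if k = 0 then 1 else 0 := by
  have e : ∀ t : ℝ, laplaceWeight y t * (w * expMonomial x (t * (starRingEnd ℂ) y) k -
        expMonomialDeriv x (t * (starRingEnd ℂ) y) k) =
      (w - x) * (laplaceWeight y t * expMonomial x (t * (starRingEnd ℂ) y) k) -
      k * (laplaceWeight y t * expMonomial x (t * (starRingEnd ℂ) y) (k - 1)) := by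
    intro t
    rw [expMonomialDeriv_eq]
    ring
  simp only [e]
  rw [integral_sub ((integrableOn_laplaceWeight_mul_expMonomial hxy k).const_mul _)
    ((integrableOn_laplaceWeight_mul_expMonomial hxy (k - 1)).const_mul _),
    integral_const_mul, integral_const_mul, integral_laplaceWeight_mul_expMonomial hxy,
    integral_laplaceWeight_mul_expMonomial hxy]
  have hu : y - x ≠ 0 := by
    rw [sub_ne_zero]
    rintro rfl
    exact lt_irrefl _ hxy
  rcases k with _ | k
  · simp [poleTerm]
    field_simp
    ring
  · simp only [poleTerm, Nat.factorial_succ, Nat.add_sub_cancel]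
    push_cast
    field_simp
    ring

theorem exists_integrable_bound_laplaceWeight_mul_sub {ρ : ℝ} (hρ : ρ < ‖y‖) (w w' : ℂ) (k : ℕ) :
    ∃ b : ℝ → ℝ, Integrable b (volume.restrict (Set.Ioi 0)) ∧
      ∀ᵐ t ∂(volume.restrict (Set.Ioi (0 : ℝ))), ∀ x : ℂ, ‖x‖ ≤ ρ →
        ‖laplaceWeight y t * (w * expMonomial x (t * (starRingEnd ℂ) y) k -
          w' * expMonomialDeriv x (t * (starRingEnd ℂ) y) k)‖ ≤ b t := by
  by_cases hρ0 : 0 ≤ ρ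
  swap
  · exact ⟨0, integrable_zero _ _ _, Filter.Eventually.of_forall fun t x hx =>
      absurd ((norm_nonneg x).trans hx) hρ0⟩
  set δ := ‖y‖ * (‖y‖ - ρ) with hδ
  have hδ0 : 0 < δ := mul_pos (hρ0.trans_lt hρ) (sub_pos.2 hρ)
  refine ⟨fun t => ((‖w‖ + ‖w'‖ * ρ) * ‖y‖ ^ (k + 1)) * (t ^ k * Real.exp (-(δ * t))) +
    (‖w'‖ * k * ‖y‖ ^ (k - 1 + 1)) * (t ^ (k - 1) * Real.exp (-(δ * t))), ?_, ?_⟩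
  · exact ((integrableOn_pow_mul_exp_neg_mul hδ0 k).const_mul _).add
      ((integrableOn_pow_mul_exp_neg_mul hδ0 (k - 1)).const_mul _)
  · filter_upwards [ae_restrict_mem measurableSet_Ioi] with t ht x hx
    have ht0 : (0 : ℝ) ≤ t := le_of_lt ht
    have hd : δ ≤ ((starRingEnd ℂ) y * (y - x)).re := mul_sub_le_re_conj_mul_sub hx
    have e : laplaceWeight y t * (w * expMonomial x (t * (starRingEnd ℂ) y) k -
          w' * expMonomialDeriv x (t * (starRingEnd ℂ) y) k) =
        (w - w' * x) * (laplaceWeight y t * expMonomial x (t * (starRingEnd ℂ) y) k) -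
        (w' * k) * (laplaceWeight y t * expMonomial x (t * (starRingEnd ℂ) y) (k - 1)) := by
      rw [expMonomialDeriv_eq]
      ring
    rw [e, laplaceWeight_mul_expMonomial, laplaceWeight_mul_expMonomial]
    refine (norm_sub_le _ _).trans (add_le_add ?_ ?_)
    · rw [norm_mul, norm_mul, norm_pow, RCLike.norm_conj, ← mul_assoc]
      gcongr
      · refine (norm_sub_le _ _).trans ?_
        rw [norm_mul]
        gcongr
      · exact norm_pow_mul_exp_neg_mul_le hd k ht0
    · rw [norm_mul, norm_mul, norm_mul, norm_pow, RCLike.norm_conj, Complex.norm_natCast,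
        ← mul_assoc]
      gcongr
      exact norm_pow_mul_exp_neg_mul_le hd _ ht0

end Laplace

section ResolventDet

variable {p : ℕ}

theorem norm_conjDiag_le {lam : Fin p → ℂ} {ρ : ℝ} (hlam : ∀ s, ‖lam s‖ ≤ ρ) (i : Fin p)
    (G : Matrix.unitaryGroup (Fin p) ℂ) : ‖conjDiag lam i G‖ ≤ ρ := by
  have h1 : conjDiag lam i G = ∑ s, (G : Matrix (Fin p) (Fin p) ℂ) i s * lam s *
      star ((G : Matrix (Fin p) (Fin p) ℂ) i s) := by
    simp [conjDiag, unitaryConj, Matrix.mul_apply, Matrix.diagonal_apply]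
  have h2 : ∑ s, ‖(G : Matrix (Fin p) (Fin p) ℂ) i s‖ ^ 2 = 1 := by
    have h := congrFun (congrFun (Matrix.mem_unitaryGroup_iff.1 G.2) i) i
    rw [Matrix.mul_apply, Matrix.one_apply_eq] at h
    have h3 : ∀ s, (G : Matrix (Fin p) (Fin p) ℂ) i s * (star (G : Matrix (Fin p) (Fin p) ℂ)) s i =
        ((‖(G : Matrix (Fin p) (Fin p) ℂ) i s‖ ^ 2 : ℝ) : ℂ) := by
      intro s
      rw [Matrix.star_apply, Complex.star_def, Complex.mul_conj', Complex.ofReal_pow]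
    rw [Finset.sum_congr rfl fun s _ => h3 s] at h
    exact_mod_cast h
  rw [h1]
  calc _ ≤ ∑ s, ‖(G : Matrix (Fin p) (Fin p) ℂ) i s‖ ^ 2 * ρ := by
        refine norm_sum_le_of_le _ fun s _ => ?_
        rw [norm_mul, norm_mul, norm_star]
        nlinarith [hlam s, sq_nonneg ‖(G : Matrix (Fin p) (Fin p) ℂ) i s‖]
    _ = ρ := by rw [← Finset.sum_mul, h2, one_mul]

theorem integral_det_poleTerm (μ : Measure (Matrix.unitaryGroup (Fin p) ℂ))
    [μ.IsMulLeftInvariant] [IsProbabilityMeasure μ] {lam : Fin p → ℂ} {ρ : ℝ}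
    (hlam : ∀ s, ‖lam s‖ ≤ ρ) {y : Fin p → ℂ} (hy : ∀ i, ρ < ‖y i‖) (w : ℂ) :
    ∫ G, (Matrix.of fun i m : Fin p => (w - y i) * poleTerm m (y i - conjDiag lam i G) +
        if (m : ℕ) = 0 then 1 else 0).det ∂μ =
      (∏ s, (w - lam s)) *
        ∫ G, (Matrix.of fun i m : Fin p => poleTerm m (y i - conjDiag lam i G)).det ∂μ := by
  have hxy : ∀ i G, ‖conjDiag lam i G‖ < ‖y i‖ := fun i G =>
    (norm_conjDiag_le hlam i G).trans_lt (hy i)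
  have hcont : ∀ (w w' : ℂ) (i m : Fin p), Continuous (Function.uncurry
      fun (t : ℝ) (G : Matrix.unitaryGroup (Fin p) ℂ) => laplaceWeight (y i) t *
        (w * expMonomial (conjDiag lam i G) (t * (starRingEnd ℂ) (y i)) m -
        w' * expMonomialDeriv (conjDiag lam i G) (t * (starRingEnd ℂ) (y i)) m)) := by
    intro w w' i m
    have := continuous_conjDiag lam i
    simp only [laplaceWeight, expMonomial, expMonomialDeriv, Function.uncurry_def]
    fun_prop
  have htrans : ∀ w w' : ℂ, ∫ t : Fin p → ℝ, (∏ i, laplaceWeight (y i) (t i)) * (∫ G, (Matrix.of fun i m : Fin p =>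
        w * expMonomial (conjDiag lam i G) (t i * (starRingEnd ℂ) (y i)) m -
        w' * expMonomialDeriv (conjDiag lam i G) (t i * (starRingEnd ℂ) (y i)) m).det ∂μ)
        ∂(Measure.pi fun _ => volume.restrict (Set.Ioi 0)) =
      ∫ G, (Matrix.of fun i m : Fin p => ∫ t : ℝ in Set.Ioi 0, laplaceWeight (y i) t *
        (w * expMonomial (conjDiag lam i G) (t * (starRingEnd ℂ) (y i)) m -
        w' * expMonomialDeriv (conjDiag lam i G) (t * (starRingEnd ℂ) (y i)) m)).det ∂μ := by
    intro w w'
    rw [← integral_pi_integral_det μ (volume.restrict (Set.Ioi 0))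
      (fun i m t G => laplaceWeight (y i) t *
        (w * expMonomial (conjDiag lam i G) (t * (starRingEnd ℂ) (y i)) m -
        w' * expMonomialDeriv (conjDiag lam i G) (t * (starRingEnd ℂ) (y i)) m)) (hcont w w')]
    · congr 1; funext t
      rw [← integral_const_mul]
      congr 1; funext G
      rw [← Matrix.det_mul_column]
      rfl
    · intro i m
      obtain ⟨b, hb, hb'⟩ := exists_integrable_bound_laplaceWeight_mul_sub (hy i) w w' m
      exact ⟨b, hb, hb'.mono fun t ht G => ht _ (norm_conjDiag_le hlam i G)⟩
  have h1 := htrans w 1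
  have h2 := htrans 1 0
  simp only [one_mul, zero_mul, sub_zero] at h1 h2
  simp only [integral_laplaceWeight_mul_sub (hxy _ _)] at h1
  simp only [integral_laplaceWeight_mul_expMonomial (hxy _ _)] at h2
  rw [← h1, ← h2, ← integral_const_mul]
  congr 1; funext t
  rw [integral_det_expMonomial μ lam (fun i => t i * (starRingEnd ℂ) (y i)) w]
  ring

end ResolventDet

section Alternant

variable {m : ℕ}

theorem Matrix.det_vandermonde_eq_prod_erase_mul {R : Type*} [CommRing R] (y : Fin m → R) (i : Fin m) :
    (Matrix.vandermonde y).det =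
      (∏ j ∈ Finset.univ.erase i, (y i - y j)) * ((∏ j ∈ Finset.univ.erase i, if j < i then 1 else -1) *
        ∏ k ∈ Finset.univ.erase i, ∏ j ∈ (Finset.Ioi k).erase i, (y j - y k)) := by
  rw [Matrix.det_vandermonde, ← Finset.mul_prod_erase _ _ (Finset.mem_univ i), ← mul_assoc,
    ← Finset.prod_mul_distrib]
  have h1 : ∏ j ∈ Finset.Ioi i, (y j - y i) =
      ∏ j ∈ Finset.univ.erase i, if i < j then y j - y i else 1 := by
    rw [Finset.prod_ite, Finset.prod_const_one, mul_one]
    refine Finset.prod_congr ?_ fun _ _ => rfl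
    ext j
    simp only [Finset.mem_Ioi, Finset.mem_filter, Finset.mem_erase, Finset.mem_univ, and_true]
    exact ⟨fun h => ⟨h.ne', h⟩, fun h => h.2⟩
  have h2 : ∀ k ∈ Finset.univ.erase i, ∏ j ∈ Finset.Ioi k, (y j - y k) =
      (if k < i then y i - y k else 1) * ∏ j ∈ (Finset.Ioi k).erase i, (y j - y k) := by
    intro k _
    split_ifs with hk
    · exact (Finset.mul_prod_erase _ (fun j => y j - y k) (Finset.mem_Ioi.2 hk)).symm
    · rw [one_mul, Finset.erase_eq_of_notMem (by simpa using hk)]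
  rw [h1, Finset.prod_congr rfl h2, Finset.prod_mul_distrib, ← mul_assoc,
    ← Finset.prod_mul_distrib]
  congr 1
  refine Finset.prod_congr rfl fun j hj => ?_
  rcases lt_or_gt_of_ne (Finset.ne_of_mem_erase hj) with h | h
  · simp [h, h.not_gt]
  · simp [h, h.not_gt]

theorem exists_eq_mul_det_vandermonde {ρ : ℝ} {f : (Fin m → ℂ) → ℂ}
    (K : Fin m → (Fin m → ℂ) → ℂ) (hK : ∀ i y z, K i (Function.update y i z) = K i y)
    (hf : ∀ i y, (∀ j, ρ < ‖y j‖) → f y = (∏ j ∈ Finset.univ.erase i, (y i - y j)) * K i y) :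
    ∃ c : ℂ, ∀ y, (∀ j, ρ < ‖y j‖) → f y = c * (Matrix.vandermonde y).det := by
  have hstep : ∀ i y z, (∀ j, ρ < ‖y j‖) → ρ < ‖z‖ →
      f (Function.update y i z) * (Matrix.vandermonde y).det =
        f y * (Matrix.vandermonde (Function.update y i z)).det := by
    intro i y z hy hz
    have hy' : ∀ j, ρ < ‖Function.update y i z j‖ := by
      intro j
      rcases eq_or_ne j i with rfl | h
      · simpa using hz
      · simpa [h] using hy j
    have hw : ∏ k ∈ Finset.univ.erase i, ∏ j ∈ (Finset.Ioi k).erase i,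
        (Function.update y i z j - Function.update y i z k) =
        ∏ k ∈ Finset.univ.erase i, ∏ j ∈ (Finset.Ioi k).erase i, (y j - y k) := by
      refine Finset.prod_congr rfl fun k hk => Finset.prod_congr rfl fun j hj => ?_
      rw [Function.update_of_ne (Finset.ne_of_mem_erase hk),
        Function.update_of_ne (Finset.ne_of_mem_erase hj)]
    rw [hf i y hy, hf i _ hy', hK, Matrix.det_vandermonde_eq_prod_erase_mul y i,
      Matrix.det_vandermonde_eq_prod_erase_mul (Function.update y i z) i, hw]
    ring
  have hpair : ∀ y z : Fin m → ℂ, (∀ j, ρ < ‖y j‖) → (∀ j, ρ < ‖z j‖) →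
      Function.Injective y → Function.Injective z → (∀ i j, y i ≠ z j) →
      f z * (Matrix.vandermonde y).det = f y * (Matrix.vandermonde z).det := by
    intro y z hy hz hyi hzi hyz
    have hind : ∀ T : Finset (Fin m), f (T.piecewise z y) * (Matrix.vandermonde y).det =
        f y * (Matrix.vandermonde (T.piecewise z y)).det := by
      intro T
      induction T using Finset.induction_on with
      | empty => simp
      | insert i T hi ih =>
        have hinj : Function.Injective (T.piecewise z y) := by
          intro a b hab
          by_cases ha : a ∈ T <;> by_cases hb : b ∈ T <;> simp [ha, hb] at hab
          · exact hzi hab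
          · exact absurd hab.symm (hyz _ _)
          · exact absurd hab (hyz _ _)
          · exact hyi hab
        have hmem : ∀ j, ρ < ‖T.piecewise z y j‖ := by
          intro j
          by_cases hj : j ∈ T
          · simpa [hj] using hz j
          · simpa [hj] using hy j
        rw [Finset.piecewise_insert]
        have h1 := hstep i _ (z i) hmem (hz i)
        have h0 := Matrix.det_vandermonde_ne_zero_iff.2 hinj
        apply mul_right_cancel₀ h0
        linear_combination (Matrix.vandermonde y).det * h1 +
          (Matrix.vandermonde (Function.update (T.piecewise z y) i (z i))).det * ih
    simpa using hind Finset.univ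
  set far : ℝ → Fin m → ℂ := fun M i => ((M + 1 + (i : ℕ) : ℝ) : ℂ) with hfar
  have hfar_inj : ∀ M, Function.Injective (far M) := by
    intro M a b hab
    simp only [hfar] at hab
    exact Fin.ext (by exact_mod_cast add_left_cancel (Complex.ofReal_injective hab))
  have hfar_norm : ∀ M, 0 ≤ M → ∀ i, M < ‖far M i‖ := by
    intro M hM i
    simp only [hfar, Complex.norm_real]
    have : (0 : ℝ) ≤ (i : ℕ) := Nat.cast_nonneg _
    rw [Real.norm_of_nonneg (by positivity)]
    linarith
  have hle : ∀ (y : Fin m → ℂ) i, ‖y i‖ ≤ ∑ j, ‖y j‖ := fun y i =>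
    Finset.single_le_sum (f := fun j => ‖y j‖) (fun _ _ => norm_nonneg _) (Finset.mem_univ i)
  set y₀ := far |ρ| with hy₀
  have hy₀ρ : ∀ j, ρ < ‖y₀ j‖ := fun j => (le_abs_self ρ).trans_lt (hfar_norm _ (abs_nonneg _) j)
  have hy₀i : Function.Injective y₀ := hfar_inj _
  refine ⟨f y₀ / (Matrix.vandermonde y₀).det, fun y hy => ?_⟩
  by_cases hyi : Function.Injective y
  · set M := |ρ| + ∑ j, ‖y j‖ + ∑ j, ‖y₀ j‖ with hM
    have s1 : 0 ≤ ∑ j, ‖y j‖ := Finset.sum_nonneg fun _ _ => norm_nonneg _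
    have s2 : 0 ≤ ∑ j, ‖y₀ j‖ := Finset.sum_nonneg fun _ _ => norm_nonneg _
    have hM0 : 0 ≤ M := by positivity
    have hz := hfar_norm M hM0
    have hzρ : ∀ j, ρ < ‖far M j‖ := fun j => by
      have := hz j
      have := le_abs_self ρ
      linarith
    have e1 := hpair y (far M) hy hzρ hyi (hfar_inj M) fun i j h => by
      have h1 := hz j
      rw [← h] at h1
      linarith [hle y i, abs_nonneg ρ]
    have e2 := hpair y₀ (far M) hy₀ρ hzρ hy₀i (hfar_inj M) fun i j h => by
      have h1 := hz j
      rw [← h] at h1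
      linarith [hle y₀ i, abs_nonneg ρ]
    have n1 := Matrix.det_vandermonde_ne_zero_iff.2 (hfar_inj M)
    have n2 := Matrix.det_vandermonde_ne_zero_iff.2 hy₀i
    rw [div_mul_eq_mul_div, eq_div_iff n2]
    apply mul_right_cancel₀ n1
    linear_combination (Matrix.vandermonde y).det * e2 - (Matrix.vandermonde y₀).det * e1
  · have h0 : (Matrix.vandermonde y).det = 0 := by
      by_contra h
      exact hyi (Matrix.det_vandermonde_ne_zero_iff.1 h)
    obtain ⟨a, b, hab, hne⟩ : ∃ a b, y a = y b ∧ a ≠ b := by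
      simpa [Function.Injective] using hyi
    rw [h0, mul_zero, hf a y hy, Finset.prod_eq_zero (Finset.mem_erase.2 ⟨hne.symm, Finset.mem_univ b⟩)
      (sub_eq_zero.2 hab), zero_mul]

theorem Matrix.det_smul_add_const_row {R : Type*} [CommRing R] (A : Matrix (Fin m) (Fin m) R)
    (c e : Fin m → R) (i₀ : Fin m) (hc : c i₀ = 0) :
    (Matrix.of fun i j => c i * A i j + e j).det =
      (∏ i ∈ Finset.univ.erase i₀, c i) * (A.updateRow i₀ e).det := by
  have h1 : (Matrix.of fun i j => c i * A i j + e j).det =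
      (Matrix.of fun i j => (if i = i₀ then 1 else c i) * A.updateRow i₀ e i j).det := by
    refine Matrix.det_eq_of_forall_row_eq_smul_add_const (fun i => if i = i₀ then 0 else 1) i₀
      (if_pos rfl) fun i j => ?_
    rcases eq_or_ne i i₀ with rfl | h
    · simp [hc]
    · simp [h]
  rw [h1, Matrix.det_mul_column, ← Finset.mul_prod_erase _ _ (Finset.mem_univ i₀), if_pos rfl,
    one_mul]
  congr 1
  exact Finset.prod_congr rfl fun i hi => if_neg (Finset.ne_of_mem_erase hi)

end Alternant

section Normalised

variable {p : ℕ}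

theorem exists_integral_det_poleTerm_eq (μ : Measure (Matrix.unitaryGroup (Fin p) ℂ))
    [μ.IsMulLeftInvariant] [IsProbabilityMeasure μ] {lam : Fin p → ℂ} {ρ : ℝ}
    (hlam : ∀ s, ‖lam s‖ ≤ ρ) :
    ∃ c : ℂ, ∀ y : Fin p → ℂ, (∀ i, ρ < ‖y i‖) →
      (∫ G, (Matrix.of fun i m : Fin p => poleTerm m (y i - conjDiag lam i G)).det ∂μ) *
        ∏ i, ∏ s, (y i - lam s) = c * (Matrix.vandermonde y).det := by
  refine exists_eq_mul_det_vandermonde (ρ := ρ)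
    (fun i y => (∫ G, ((Matrix.of fun i m : Fin p =>
      poleTerm m (y i - conjDiag lam i G)).updateRow i fun m => if (m : ℕ) = 0 then 1 else 0).det ∂μ) *
        ∏ j ∈ Finset.univ.erase i, ∏ s, (y j - lam s)) ?_ ?_
  · intro i y z
    congr 1
    · congr 1; funext G; congr 1
      ext a b
      rcases eq_or_ne a i with rfl | h
      · simp
      · simp [h]
    · refine Finset.prod_congr rfl fun j hj => ?_
      rw [Function.update_of_ne (Finset.ne_of_mem_erase hj)]
  · intro i y hy
    have h := integral_det_poleTerm μ hlam hy (y i)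
    have h2 : ∀ G, (Matrix.of fun k m : Fin p => (y i - y k) * poleTerm m (y k - conjDiag lam k G) +
        if (m : ℕ) = 0 then 1 else 0).det = (∏ j ∈ Finset.univ.erase i, (y i - y j)) *
        ((Matrix.of fun i m : Fin p => poleTerm m (y i - conjDiag lam i G)).updateRow i
          fun m => if (m : ℕ) = 0 then 1 else 0).det := fun G =>
      Matrix.det_smul_add_const_row _ (fun k => y i - y k) _ i (sub_self _)
    rw [funext h2, integral_const_mul] at h
    rw [← mul_assoc, h, ← Finset.mul_prod_erase _ _ (Finset.mem_univ i)]
    ring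

end Normalised

section Descent

theorem Matrix.det_vandermonde_snoc {R : Type*} [CommRing R] {m : ℕ} (y : Fin m → R) (z : R) :
    (Matrix.vandermonde (Fin.snoc y z : Fin (m + 1) → R)).det =
      (Matrix.vandermonde y).det * ∏ i, (z - y i) := by
  have hIoi : ∀ (k : ℕ) (f : Fin k → R) (i : Fin k),
      ∏ j ∈ Finset.Ioi i, f j = ∏ j, if i < j then f j else 1 := by
    intro k f i
    rw [Finset.prod_ite, Finset.prod_const_one, mul_one]
    refine Finset.prod_congr ?_ fun _ _ => rfl
    ext j
    simp
  rw [Matrix.det_vandermonde, Matrix.det_vandermonde]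
  simp only [hIoi]
  rw [Fin.prod_univ_castSucc, ← Finset.prod_mul_distrib]
  simp only [Fin.prod_univ_castSucc, Fin.snoc_castSucc, Fin.snoc_last, Fin.castSucc_lt_castSucc_iff,
    Fin.castSucc_lt_last, if_true, lt_self_iff_false, if_false, mul_one]
  simp [not_lt.2 (Fin.le_last _)]

theorem Matrix.det_of_last_row_eq_single {R : Type*} [CommRing R] {m : ℕ}
    (A : Matrix (Fin (m + 1)) (Fin (m + 1)) R) (hA : ∀ j : Fin m, A (Fin.last m) j.succ = 0) :
    A.det = (-1) ^ m * A (Fin.last m) 0 *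
      (Matrix.of fun i j : Fin m => A i.castSucc j.succ).det := by
  rw [Matrix.det_succ_row A (Fin.last m), Fin.sum_univ_succ]
  simp only [hA, mul_zero, zero_mul, Finset.sum_const_zero, add_zero]
  rw [Fin.val_last, Fin.val_zero, add_zero]
  congr 2
  ext i j
  simp

variable {p : ℕ}

theorem integral_det_poleTerm_descent (μ : Measure (Matrix.unitaryGroup (Fin p) ℂ))
    [IsProbabilityMeasure μ] {lam : Fin p → ℂ} {ρ : ℝ} (hlam : ∀ s, ‖lam s‖ ≤ ρ)
    {m k : ℕ} (hm : m + 1 + k = p) {c : ℂ}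
    (hc : ∀ y : Fin (m + 1) → ℂ, (∀ i, ρ < ‖y i‖) →
      (∫ G, (Matrix.of fun i j : Fin (m + 1) =>
        poleTerm (k + j) (y i - conjDiag lam (Fin.castLE (by lia) i) G)).det ∂μ) *
        ∏ i, ∏ s, (y i - lam s) = c * (Matrix.vandermonde y).det)
    (y : Fin m → ℂ) (hy : ∀ i, ρ < ‖y i‖) :
      (-1) ^ m * (k.factorial : ℂ) * (∫ G, (Matrix.of fun i j : Fin m =>
        poleTerm (k + 1 + j) (y i - conjDiag lam (Fin.castLE (by lia) i) G)).det ∂μ) *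
        ∏ i, ∏ s, (y i - lam s) = c * (Matrix.vandermonde y).det := by
  set X : Set ℂ := {u | ‖u‖ * ρ < 1} with hX
  have hXo : IsOpen X := isOpen_lt (by fun_prop) continuous_const
  have : LocallyCompactSpace X := hXo.locallyCompactSpace
  have hle : m + 1 ≤ p := by lia
  set x : Fin (m + 1) → Matrix.unitaryGroup (Fin p) ℂ → ℂ :=
    fun i G => conjDiag lam (Fin.castLE hle i) G with hx
  have hxc : ∀ i, Continuous (x i) := fun i => continuous_conjDiag lam _
  have hxn : ∀ i G, ‖x i G‖ ≤ ρ := fun i G => norm_conjDiag_le hlam _ G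
  set A : ℂ → Matrix.unitaryGroup (Fin p) ℂ → Matrix (Fin (m + 1)) (Fin (m + 1)) ℂ := fun u G =>
    Fin.snoc (fun i j => poleTerm (k + j) (y i - x i.castSucc G))
      (fun j => ((k + j).factorial : ℂ) * (u ^ (j : ℕ) * ((1 - u * x (Fin.last m) G) ^ (k + j + 1))⁻¹))
    with hA
  have hA1 : ∀ u G (i : Fin m) j, A u G i.castSucc j = poleTerm (k + j) (y i - x i.castSucc G) := by
    intro u G i j
    simp [hA]
  have hA2 : ∀ u G j, A u G (Fin.last m) j = ((k + j).factorial : ℂ) *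
      (u ^ (j : ℕ) * ((1 - u * x (Fin.last m) G) ^ (k + j + 1))⁻¹) := by
    intro u G j
    simp [hA]
  have hne1 : ∀ (i : Fin m) (G), y i - x i.castSucc G ≠ 0 := by
    intro i G h
    have h1 := hxn i.castSucc G
    rw [← sub_eq_zero.1 h] at h1
    exact absurd (hy i) (not_lt.2 h1)
  have hne2 : ∀ u ∈ X, ∀ G, 1 - u * x (Fin.last m) G ≠ 0 := by
    intro u hu G h
    have h1 : ‖u * x (Fin.last m) G‖ ≤ ‖u‖ * ρ := by
      rw [norm_mul]
      exact mul_le_mul_of_nonneg_left (hxn _ _) (norm_nonneg _)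
    rw [← sub_eq_zero.1 h, norm_one] at h1
    exact absurd hu (not_lt.2 h1)
  have hcont : Continuous fun u : X => ∫ G, (A u G).det ∂μ := by
    apply continuous_integral_of_continuous_uncurry
    refine Continuous.matrix_det (continuous_matrix fun i j => ?_)
    induction i using Fin.lastCases with
    | last =>
      simp only [hA2]
      have h1 : Continuous fun q : X × Matrix.unitaryGroup (Fin p) ℂ =>
          (1 - (q.1 : ℂ) * x (Fin.last m) q.2) ^ (k + j + 1) := by
        have := hxc (Fin.last m)
        fun_prop
      have h2 := h1.inv₀ fun q => pow_ne_zero _ (hne2 q.1 q.1.2 q.2)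
      exact continuous_const.mul ((by fun_prop : Continuous fun q : X ×
        Matrix.unitaryGroup (Fin p) ℂ => (q.1 : ℂ) ^ (j : ℕ)).mul h2)
    | cast i =>
      simp only [hA1, poleTerm]
      have h1 : Continuous fun q : X × Matrix.unitaryGroup (Fin p) ℂ =>
          (y i - x i.castSucc q.2) ^ (k + j + 1) := by
        have := hxc i.castSucc
        fun_prop
      exact continuous_const.mul (h1.inv₀ fun q => pow_ne_zero _ (hne1 i q.2))
  have hid : ∀ u ∈ X, u ≠ 0 → (∫ G, (A u G).det ∂μ) * (∏ i, ∏ s, (y i - lam s)) *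
      ∏ s, (1 - u * lam s) = c * (Matrix.vandermonde y).det * ∏ i, (1 - u * y i) := by
    intro u hu hu0
    have hz : ρ < ‖u⁻¹‖ := by
      rw [norm_inv, ← one_div, lt_div_iff₀ (norm_pos_iff.2 hu0), mul_comm]
      exact hu
    have h1 := hc (Fin.snoc y u⁻¹) fun i => by
      induction i using Fin.lastCases with
      | last => simpa using hz
      | cast i => simpa using hy i
    rw [Matrix.det_vandermonde_snoc, Fin.prod_univ_castSucc] at h1
    simp only [Fin.snoc_castSucc, Fin.snoc_last] at h1
    have h2 : ∀ G, (Matrix.of fun i j : Fin (m + 1) =>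
        poleTerm (k + j) ((Fin.snoc y u⁻¹ : Fin (m + 1) → ℂ) i - x i G)).det =
        u ^ (k + 1) * (A u G).det := by
      intro G
      have h3 : (Matrix.of fun i j : Fin (m + 1) =>
          poleTerm (k + j) ((Fin.snoc y u⁻¹ : Fin (m + 1) → ℂ) i - x i G)) =
          Matrix.of fun i j => (Fin.snoc (fun _ => 1) (u ^ (k + 1)) : Fin (m + 1) → ℂ) i * A u G i j := by
        ext i j
        induction i using Fin.lastCases with
        | last =>
          simp only [Matrix.of_apply, Fin.snoc_last, hA2, poleTerm]
          have h4 : u⁻¹ - x (Fin.last m) G = u⁻¹ * (1 - u * x (Fin.last m) G) := by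
            field_simp
          have := hne2 u hu G
          rw [h4, mul_pow, inv_pow, mul_inv, inv_inv]
          field_simp
          ring
        | cast i => simp [hA1]
      rw [h3, Matrix.det_mul_column, Fin.prod_univ_castSucc]
      simp
    have h5 : ∏ s, (u⁻¹ - lam s) = (u ^ p)⁻¹ * ∏ s, (1 - u * lam s) := by
      have : ∀ s, u⁻¹ - lam s = u⁻¹ * (1 - u * lam s) := fun s => by field_simp
      simp only [this, Finset.prod_mul_distrib, Finset.prod_const, Finset.card_univ,
        Fintype.card_fin, inv_pow]
    have h6 : ∏ i, (u⁻¹ - y i) = (u ^ m)⁻¹ * ∏ i, (1 - u * y i) := by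
      have : ∀ s, u⁻¹ - y s = u⁻¹ * (1 - u * y s) := fun s => by field_simp
      simp only [this, Finset.prod_mul_distrib, Finset.prod_const, Finset.card_univ,
        Fintype.card_fin, inv_pow]
    change (∫ G, (Matrix.of fun i j : Fin (m + 1) =>
        poleTerm (k + j) ((Fin.snoc y u⁻¹ : Fin (m + 1) → ℂ) i - x i G)).det ∂μ) * _ = _ at h1
    rw [funext h2, integral_const_mul, h5, h6] at h1
    have h7 : u ^ p = u ^ (k + 1) * u ^ m := by
      rw [← pow_add]
      congr 1
      lia
    rw [h7] at h1
    field_simp at h1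
    linear_combination h1
  have h0 : (0 : ℂ) ∈ X := by simp [hX]
  have hlim : (∫ G, (A 0 G).det ∂μ) * (∏ i, ∏ s, (y i - lam s)) *
      ∏ s, (1 - 0 * lam s) = c * (Matrix.vandermonde y).det * ∏ i, (1 - 0 * y i) := by
    have hc1 : ContinuousOn (fun u => (∫ G, (A u G).det ∂μ) * (∏ i, ∏ s, (y i - lam s)) *
        ∏ s, (1 - u * lam s)) X := by
      refine ContinuousOn.mul (ContinuousOn.mul ?_ continuousOn_const) (by fun_prop)
      exact continuousOn_iff_continuous_domRestrict.2 hcont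
    have hc2 : Continuous fun u => c * (Matrix.vandermonde y).det * ∏ i, (1 - u * y i) := by
      fun_prop
    have hn := hXo.mem_nhds h0
    refine tendsto_nhds_unique_of_eventuallyEq (l := nhdsWithin (0 : ℂ) {0}ᶜ)
      ((hc1.continuousAt hn).tendsto.mono_left nhdsWithin_le_nhds)
      ((hc2.tendsto 0).mono_left nhdsWithin_le_nhds) ?_
    filter_upwards [self_mem_nhdsWithin, mem_nhdsWithin_of_mem_nhds hn] with u hu hu'
    exact hid u hu' hu
  have hdet0 : ∀ G, (A 0 G).det = (-1) ^ m * (k.factorial : ℂ) * (Matrix.of fun i j : Fin m =>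
        poleTerm (k + 1 + j) (y i - conjDiag lam (Fin.castLE (by lia) i) G)).det := by
    intro G
    rw [Matrix.det_of_last_row_eq_single (A 0 G) fun j => by rw [hA2]; simp]
    congr 2
    · rw [hA2]
      simp
    · ext i j
      simp only [Matrix.of_apply, hA1]
      congr 1
      simp
      ring
  rw [funext hdet0, integral_const_mul] at hlim
  simpa using hlim

end Descent

section Averages

variable {p : ℕ}

theorem exists_injective_forall_lt_norm (m : ℕ) (ρ : ℝ) :
    ∃ y : Fin m → ℂ, Function.Injective y ∧ ∀ i, ρ < ‖y i‖ := by
  refine ⟨fun i => ((|ρ| + 1 + (i : ℕ) : ℝ) : ℂ), fun a b hab => ?_, fun i => ?_⟩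
  · exact Fin.ext (by exact_mod_cast add_left_cancel (Complex.ofReal_injective hab))
  · have : (0 : ℝ) ≤ (i : ℕ) := Nat.cast_nonneg _
    rw [Complex.norm_real, Real.norm_of_nonneg (by positivity)]
    linarith [le_abs_self ρ]

theorem exists_integral_det_poleTerm_add_eq (μ : Measure (Matrix.unitaryGroup (Fin p) ℂ))
    [μ.IsMulLeftInvariant] [IsProbabilityMeasure μ] {lam : Fin p → ℂ} {ρ : ℝ}
    (hlam : ∀ s, ‖lam s‖ ≤ ρ) (k m : ℕ) (hm : m + k = p) :
    ∃ c : ℂ, ∀ y : Fin m → ℂ, (∀ i, ρ < ‖y i‖) →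
      (∫ G, (Matrix.of fun i j : Fin m =>
        poleTerm (k + j) (y i - conjDiag lam (Fin.castLE (by lia) i) G)).det ∂μ) *
        ∏ i, ∏ s, (y i - lam s) = c * (Matrix.vandermonde y).det := by
  induction k generalizing m with
  | zero =>
    obtain rfl : m = p := by lia
    simpa using exists_integral_det_poleTerm_eq μ hlam
  | succ k ih =>
    obtain ⟨c, hc⟩ := ih (m + 1) (by lia)
    have h := integral_det_poleTerm_descent μ hlam (m := m) (k := k) (by lia) hc
    refine ⟨((-1) ^ m * (k.factorial : ℂ))⁻¹ * c, fun y hy => ?_⟩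
    have h0 : (-1 : ℂ) ^ m * (k.factorial : ℂ) ≠ 0 :=
      mul_ne_zero (pow_ne_zero _ (by norm_num)) (Nat.cast_ne_zero.2 (Nat.factorial_ne_zero k))
    apply mul_left_cancel₀ h0
    rw [← mul_assoc, h y hy, ← mul_assoc, ← mul_assoc, mul_inv_cancel₀ h0, one_mul]

/-- The averaged determinant of pole terms is a Vandermonde determinant divided by values of the
characteristic polynomial. -/
theorem integral_det_poleTerm_add (μ : Measure (Matrix.unitaryGroup (Fin p) ℂ))
    [μ.IsMulLeftInvariant] [IsProbabilityMeasure μ] {lam : Fin p → ℂ} {ρ : ℝ}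
    (hlam : ∀ s, ‖lam s‖ ≤ ρ) (m k : ℕ) (hm : m + k = p)
    (y : Fin m → ℂ) (hy : ∀ i, ρ < ‖y i‖) :
      (∫ G, (Matrix.of fun i j : Fin m =>
        poleTerm (k + j) (y i - conjDiag lam (Fin.castLE (by lia) i) G)).det ∂μ) *
        ∏ i, ∏ s, (y i - lam s) =
      (∏ t : Fin m, (-1) ^ (t : ℕ) * ((p - 1 - (t : ℕ)).factorial : ℂ)) *
        (Matrix.vandermonde y).det := by
  induction m generalizing k with
  | zero => simp
  | succ m ih =>
    obtain ⟨c, hc⟩ := exists_integral_det_poleTerm_add_eq μ hlam k (m + 1) hm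
    rw [hc y hy]
    obtain ⟨z, hzi, hz⟩ := exists_injective_forall_lt_norm m ρ
    have h := integral_det_poleTerm_descent μ hlam hm hc z hz
    rw [mul_assoc, ih (k + 1) (by lia) z hz, ← mul_assoc] at h
    rw [← mul_right_cancel₀ (Matrix.det_vandermonde_ne_zero_iff.2 hzi) h, Fin.prod_univ_castSucc,
      Fin.val_last, show p - 1 - m = k by lia]
    simp only [Fin.val_castSucc]
    ring

end Averages

section Inversion

theorem hasDerivAt_exp_mul_poleTerm {a x z : ℂ} (hz : z - x ≠ 0) (k : ℕ) :
    HasDerivAt (fun z => cexp (a * z) * poleTerm k (z - x))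
      (a * (cexp (a * z) * poleTerm k (z - x)) - cexp (a * z) * poleTerm (k + 1) (z - x)) z := by
  have h1 : HasDerivAt (fun z => cexp (a * z)) (cexp (a * z) * a) z := by
    simpa using ((hasDerivAt_id z).const_mul a).cexp
  have h2 : HasDerivAt (fun z => (z - x) ^ (k + 1)) (((k + 1 : ℕ) : ℂ) * (z - x) ^ k) z := by
    simpa using ((hasDerivAt_id' z).sub_const x).fun_pow (k + 1)
  have h3 := h1.fun_mul ((h2.fun_inv (pow_ne_zero _ hz)).const_mul (k.factorial : ℂ))
  refine h3.congr_deriv ?_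
  simp only [poleTerm, Nat.factorial_succ]
  push_cast
  field_simp
  ring

theorem continuousOn_exp_mul_poleTerm {a x : ℂ} {R : ℝ} (hx : ‖x‖ < R) (k : ℕ) :
    ContinuousOn (fun z => cexp (a * z) * poleTerm k (z - x)) (Metric.sphere 0 R) := by
  intro z hz
  refine (hasDerivAt_exp_mul_poleTerm (a := a) ?_ k).continuousAt.continuousWithinAt
  rw [sub_ne_zero]
  rintro rfl
  exact hx.ne (by simpa using hz)

theorem circleIntegral_exp_mul_poleTerm {a x : ℂ} {R : ℝ} (hx : ‖x‖ < R) (k : ℕ) :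
    (2 * π * I)⁻¹ * (∮ z in C(0, R), cexp (a * z) * poleTerm k (z - x)) = expMonomial x a k := by
  have hR : 0 ≤ R := (norm_nonneg x).trans hx.le
  induction k with
  | zero =>
    have h := Complex.two_pi_I_inv_smul_circleIntegral_sub_inv_smul_of_differentiable_on_off_countable
      (f := fun z => cexp (a * z)) (c := 0) (R := R) (w := x) Set.countable_empty (by simpa using hx)
      (by fun_prop) (fun z _ => by fun_prop)
    simp only [smul_eq_mul] at h
    simpa [poleTerm, expMonomial, mul_comm] using h
  | succ k ih =>
    have h0 : ∮ z in C(0, R), (a * (cexp (a * z) * poleTerm k (z - x)) -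
        cexp (a * z) * poleTerm (k + 1) (z - x)) = 0 := by
      refine circleIntegral.integral_eq_zero_of_hasDerivWithinAt hR fun z hz =>
        (hasDerivAt_exp_mul_poleTerm ?_ k).hasDerivWithinAt
      rw [sub_ne_zero]
      rintro rfl
      exact hx.ne (by simpa using hz)
    have hk : CircleIntegrable (fun z => a * (cexp (a * z) * poleTerm k (z - x))) 0 R :=
      (continuousOn_const.mul (continuousOn_exp_mul_poleTerm hx k)).circleIntegrable hR
    rw [circleIntegral.integral_sub hk
      ((continuousOn_exp_mul_poleTerm hx (k + 1)).circleIntegrable hR),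
      circleIntegral.integral_const_mul, sub_eq_zero] at h0
    rw [← h0, mul_left_comm, ih]
    simp only [expMonomial]
    ring

theorem two_pi_I_inv_mul_circleIntegral_eq (R : ℝ) (f : ℂ → ℂ) :
    (2 * π * I)⁻¹ * (∮ z in C(0, R), f z) = ∫ θ : ℝ in Set.Ioc 0 (2 * π),
      (2 * π * I)⁻¹ * (circleMap 0 R θ * I) * f (circleMap 0 R θ) := by
  rw [circleIntegral, intervalIntegral.integral_of_le (by positivity), ← integral_const_mul]
  simp only [deriv_circleMap, smul_eq_mul, mul_assoc]

theorem exists_integrable_bound_of_continuous {G : Type*} [TopologicalSpace G] [CompactSpace G]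
    {f : ℝ → G → ℂ} (hf : Continuous (Function.uncurry f)) (a b : ℝ) :
    ∃ B : ℝ → ℝ, Integrable B (volume.restrict (Set.Ioc a b)) ∧
      ∀ᵐ t ∂(volume.restrict (Set.Ioc a b)), ∀ g, ‖f t g‖ ≤ B t := by
  obtain ⟨C, hC⟩ := ((isCompact_Icc (a := a) (b := b)).prod
    (isCompact_univ (X := G))).exists_bound_of_continuousOn hf.continuousOn
  refine ⟨fun _ => C, integrable_const C, ?_⟩
  filter_upwards [ae_restrict_mem measurableSet_Ioc] with t ht g
  exact hC (t, g) ⟨Set.Ioc_subset_Icc_self ht, Set.mem_univ g⟩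

variable {p : ℕ}

theorem integral_det_expMonomial_eq_det_circleIntegral
    (μ : Measure (Matrix.unitaryGroup (Fin p) ℂ)) [μ.IsMulLeftInvariant] [IsProbabilityMeasure μ]
    {lam : Fin p → ℂ} {ρ R : ℝ} (hlam : ∀ s, ‖lam s‖ ≤ ρ) (hρ : ρ < R) (hR : 0 ≤ R)
    (m k : ℕ) (hm : m + k = p) (a : Fin m → ℂ) :
    ∫ G, (Matrix.of fun i j : Fin m =>
        expMonomial (conjDiag lam (Fin.castLE (by lia) i) G) (a i) (k + j)).det ∂μ =
      (∏ t : Fin m, (-1) ^ (t : ℕ) * ((p - 1 - (t : ℕ)).factorial : ℂ)) *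
        (Matrix.of fun i j : Fin m => (2 * π * I)⁻¹ * ∮ z in C(0, R),
          cexp (a i * z) * (z ^ (j : ℕ) * ∏ s, (z - lam s)⁻¹)).det := by
  have hle : m ≤ p := by lia
  have hz : ∀ θ, ‖circleMap 0 R θ‖ = R := fun θ => by simp [abs_of_nonneg hR]
  have hx : ∀ (i : Fin m) G, ‖conjDiag lam (Fin.castLE hle i) G‖ < R := fun i G =>
    (norm_conjDiag_le hlam _ G).trans_lt hρ
  have hne : ∀ θ (x : ℂ), ‖x‖ < R → circleMap 0 R θ - x ≠ 0 := by
    intro θ x h h0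
    rw [← sub_eq_zero.1 h0, hz] at h
    exact lt_irrefl _ h
  have hzc := continuous_circleMap 0 R
  set W : Fin m → ℝ → ℂ := fun i θ =>
    (2 * π * I)⁻¹ * (circleMap 0 R θ * I) * cexp (a i * circleMap 0 R θ) with hW
  have hWc : ∀ i, Continuous (W i) := fun i => by
    simp only [hW]
    fun_prop
  have hf1 : ∀ i j : Fin m, Continuous (Function.uncurry
      fun (θ : ℝ) (G : Matrix.unitaryGroup (Fin p) ℂ) =>
        W i θ * poleTerm (k + j) (circleMap 0 R θ - conjDiag lam (Fin.castLE hle i) G)) := by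
    intro i j
    simp only [Function.uncurry_def, poleTerm]
    have h1 : Continuous fun q : ℝ × Matrix.unitaryGroup (Fin p) ℂ =>
        (circleMap 0 R q.1 - conjDiag lam (Fin.castLE hle i) q.2) ^ (k + j + 1) := by
      have := continuous_conjDiag lam (Fin.castLE hle i)
      fun_prop
    exact ((hWc i).comp continuous_fst).mul
      (continuous_const.mul (h1.inv₀ fun q => pow_ne_zero _ (hne _ _ (hx i q.2))))
  have hf2 : ∀ i j : Fin m, Continuous (Function.uncurry
      fun (θ : ℝ) (_ : Matrix.unitaryGroup (Fin p) ℂ) =>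
        W i θ * (circleMap 0 R θ ^ (j : ℕ) * ∏ s, (circleMap 0 R θ - lam s)⁻¹)) := by
    intro i j
    simp only [Function.uncurry_def]
    have h1 : Continuous fun q : ℝ × Matrix.unitaryGroup (Fin p) ℂ =>
        ∏ s, (circleMap 0 R q.1 - lam s)⁻¹ := by
      refine continuous_finsetProd _ fun s _ => Continuous.inv₀ (by fun_prop) fun q => ?_
      exact hne _ _ ((hlam s).trans_lt hρ)
    exact ((hWc i).comp continuous_fst).mul ((by fun_prop : Continuous
      fun q : ℝ × Matrix.unitaryGroup (Fin p) ℂ => circleMap 0 R q.1 ^ (j : ℕ)).mul h1)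
  have e1 := integral_pi_integral_det μ (volume.restrict (Set.Ioc 0 (2 * π))) _ hf1
    fun i j => exists_integrable_bound_of_continuous (hf1 i j) _ _
  have e2 := integral_pi_integral_det μ (volume.restrict (Set.Ioc 0 (2 * π))) _ hf2
    fun i j => exists_integrable_bound_of_continuous (hf2 i j) _ _
  have t1 : ∀ (i j : Fin m) G, ∫ θ : ℝ in Set.Ioc 0 (2 * π), W i θ *
      poleTerm (k + j) (circleMap 0 R θ - conjDiag lam (Fin.castLE hle i) G) =
      expMonomial (conjDiag lam (Fin.castLE hle i) G) (a i) (k + j) := by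
    intro i j G
    rw [← circleIntegral_exp_mul_poleTerm (hx i G), two_pi_I_inv_mul_circleIntegral_eq]
    simp only [hW, mul_assoc]
  have t2 : ∀ i j : Fin m, ∫ θ : ℝ in Set.Ioc 0 (2 * π), W i θ *
      (circleMap 0 R θ ^ (j : ℕ) * ∏ s, (circleMap 0 R θ - lam s)⁻¹) =
      (2 * π * I)⁻¹ * ∮ z in C(0, R), cexp (a i * z) * (z ^ (j : ℕ) * ∏ s, (z - lam s)⁻¹) := by
    intro i j
    rw [two_pi_I_inv_mul_circleIntegral_eq]
    simp only [hW, mul_assoc]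
  simp only [t1] at e1
  simp only [t2, integral_const, probReal_univ, one_smul] at e2
  rw [← e1, ← e2, ← integral_const_mul]
  congr 1; funext θ
  have hrow : ∀ M : Matrix (Fin m) (Fin m) ℂ,
      (Matrix.of fun i j => W i (θ i) * M i j).det = (∏ i, W i (θ i)) * M.det :=
    fun M => Matrix.det_mul_column _ M
  have r1 : ∀ G, (Matrix.of fun i j : Fin m => W i (θ i) * poleTerm (k + j)
      (circleMap 0 R (θ i) - conjDiag lam (Fin.castLE hle i) G)).det = (∏ i, W i (θ i)) *
      (Matrix.of fun i j : Fin m => poleTerm (k + j)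
      (circleMap 0 R (θ i) - conjDiag lam (Fin.castLE hle i) G)).det := fun G => hrow _
  have r2 : (Matrix.of fun i j : Fin m => W i (θ i) * (circleMap 0 R (θ i) ^ (j : ℕ) *
      ∏ s, (circleMap 0 R (θ i) - lam s)⁻¹)).det = (∏ i, W i (θ i)) *
      ((∏ i, ∏ s, (circleMap 0 R (θ i) - lam s)⁻¹) *
        (Matrix.vandermonde fun i => circleMap 0 R (θ i)).det) := by
    rw [← Matrix.det_mul_column, ← hrow]
    congr 1
    ext i j
    simp only [Matrix.of_apply, Matrix.vandermonde_apply]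
    ring
  have key := integral_det_poleTerm_add μ hlam m k hm (fun i => circleMap 0 R (θ i))
    fun i => by rw [hz]; exact hρ
  have hP : ∏ i, ∏ s, (circleMap 0 R (θ i) - lam s) ≠ 0 :=
    Finset.prod_ne_zero_iff.2 fun i _ => Finset.prod_ne_zero_iff.2 fun s _ =>
      hne _ _ ((hlam s).trans_lt hρ)
  rw [funext r1, integral_const_mul, r2, eq_div_of_mul_eq hP key]
  simp only [Finset.prod_inv_distrib]
  field_simp

end Inversion

section Spiked

variable {p : ℕ}

theorem prod_pow_mul_det_vandermonde_mul_integral_exp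
    (μ : Measure (Matrix.unitaryGroup (Fin p) ℂ)) [μ.IsMulLeftInvariant] [IsProbabilityMeasure μ]
    {lam : Fin p → ℂ} {ρ R : ℝ} (hlam : ∀ s, ‖lam s‖ ≤ ρ) (hρ : ρ < R) (hR : 0 ≤ R)
    (m k : ℕ) (hm : m + k = p) (a : Fin m → ℂ) :
    (∏ i, a i ^ k) * (Matrix.vandermonde a).det *
        ∫ G, cexp (∑ i, a i * conjDiag lam (Fin.castLE (by lia) i) G) ∂μ =
      (∏ t : Fin m, (-1) ^ (t : ℕ) * ((p - 1 - (t : ℕ)).factorial : ℂ)) *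
        (Matrix.of fun i j : Fin m => (2 * π * I)⁻¹ * ∮ z in C(0, R),
          cexp (a i * z) * (z ^ (j : ℕ) * ∏ s, (z - lam s)⁻¹)).det := by
  rw [← integral_det_expMonomial_eq_det_circleIntegral μ hlam hρ hR m k hm a,
    ← integral_const_mul]
  congr 1; funext G
  rw [Complex.exp_sum, mul_right_comm, ← Finset.prod_mul_distrib, ← Matrix.det_mul_column]
  congr 1
  ext i j
  simp only [Matrix.of_apply, Matrix.vandermonde_apply, expMonomial]
  ring

theorem prod_univ_pow_val (r : ℕ) (c : ℂ) : ∏ t : Fin r, c ^ (t : ℕ) = c ^ (r * (r - 1) / 2) := by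
  rw [Finset.prod_pow_eq_pow_sum, Fin.sum_univ_eq_sum_range (fun i => i), Finset.sum_range_id]

theorem Matrix.det_vandermonde_const_mul {r : ℕ} (c : ℂ) (v : Fin r → ℂ) :
    (Matrix.vandermonde fun i => c * v i).det =
      c ^ (r * (r - 1) / 2) * (Matrix.vandermonde v).det := by
  rw [← prod_univ_pow_val, ← Matrix.det_mul_row]
  congr 1
  ext i j
  simp [Matrix.vandermonde_apply, mul_pow]

theorem Matrix.det_vandermonde_div_one_add {r : ℕ} (c : ℂ) (h : Fin r → ℂ)
    (h0 : ∀ i, 1 + h i ≠ 0) :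
    (Matrix.vandermonde fun i => c * h i / (1 + h i)).det =
      (∏ i, ((1 + h i) ^ (r - 1))⁻¹) * (c ^ (r * (r - 1) / 2) * (Matrix.vandermonde h).det) := by
  have h1 : (Matrix.vandermonde fun i => c * h i).det =
      (Matrix.projVandermonde (fun i => c * h i) fun i => 1 + h i).det := by
    rw [Matrix.det_projVandermonde, Matrix.det_vandermonde]
    exact Finset.prod_congr rfl fun i _ => Finset.prod_congr rfl fun j _ => by ring
  rw [← Matrix.det_vandermonde_const_mul, h1, ← Matrix.det_mul_column]
  congr 1
  ext i j
  have hj : r - 1 = (j : ℕ) + (j.rev : ℕ) := by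
    rw [Fin.val_rev]
    lia
  have := h0 i
  simp only [Matrix.of_apply, Matrix.vandermonde_apply, Matrix.projVandermonde_apply, hj, pow_add,
    div_pow]
  field_simp

theorem prod_filter_lt_sub_eq_det_vandermonde {r : ℕ} (h : Fin r → ℂ) :
    ∏ i : Fin r, ∏ j ∈ Finset.univ.filter (· < i), (h i - h j) = (Matrix.vandermonde h).det := by
  rw [Matrix.det_vandermonde]
  exact Finset.prod_comm' (by simp)

theorem trace_diagonal_sub_one_mul_conj {r k : ℕ} (c : Fin r → ℂ) (lam : Fin (r + k) → ℂ)
    (G : Matrix.unitaryGroup (Fin (r + k)) ℂ) :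
    Matrix.trace ((Matrix.diagonal (fun j : Fin (r + k) =>
        if hj : (j : ℕ) < r then c ⟨(j : ℕ), hj⟩ else 1) -
        (1 : Matrix (Fin (r + k)) (Fin (r + k)) ℂ)) * (G : Matrix (Fin (r + k)) (Fin (r + k)) ℂ) *
        Matrix.diagonal lam *
        ((G⁻¹ : Matrix.unitaryGroup (Fin (r + k)) ℂ) : Matrix (Fin (r + k)) (Fin (r + k)) ℂ)) =
      ∑ i, (c i - 1) * conjDiag lam (Fin.castLE (by lia) i) G := by
  have h1 : ∀ d : Fin (r + k) → ℂ, Matrix.trace ((Matrix.diagonal d -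
        (1 : Matrix (Fin (r + k)) (Fin (r + k)) ℂ)) * (G : Matrix (Fin (r + k)) (Fin (r + k)) ℂ) *
        Matrix.diagonal lam *
        ((G⁻¹ : Matrix.unitaryGroup (Fin (r + k)) ℂ) : Matrix (Fin (r + k)) (Fin (r + k)) ℂ)) =
      ∑ i, (d i - 1) * conjDiag lam i G := by
    intro d
    rw [← Matrix.diagonal_one, Matrix.diagonal_sub, Matrix.mul_assoc, Matrix.mul_assoc,
      ← Matrix.mul_assoc (G : Matrix (Fin (r + k)) (Fin (r + k)) ℂ)]
    simp only [Matrix.trace, Matrix.diag_apply, Matrix.diagonal_mul]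
    rfl
  rw [h1, Fin.sum_univ_add]
  simp
  rfl

end Spiked

/-- Proposition 2 of the paper (λ-based likelihood ratio): with
`Π = diag((1+h₁)⁻¹,…,(1+h_r)⁻¹,1,…,1)`, `Λ = diag(λ₁,…,λ_p)` and `R > max λ_s`,
`∏ᵢ(1+hᵢ)^{−n} ∫_{U(p)} exp(−n tr((Π−I) G Λ G⁻¹)) dG
  = k₁ det_{1≤i,j≤r} ( (2πi)⁻¹ ∮_{|z|=R} e^{n hᵢ z/(1+hᵢ)} z^{j−1} ∏ₛ(z−λₛ)⁻¹ dz )`,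
`dG` denoting the Haar probability measure on `U(p)`. -/
theorem likelihood_ratio_lambda_contour (n p r : ℕ) (hn : 1 ≤ n) (hp : 1 ≤ p)
    (hr : 1 ≤ r) (hrp : r ≤ p)
    (h : Fin r → ℝ) (hpos : ∀ i, 0 < h i)
    (hdist : ∀ i j : Fin r, i ≠ j → h i ≠ h j)
    (lam : Fin p → ℝ) (hlam : ∀ s, 0 ≤ lam s)
    (R : ℝ) (hR : ∀ s : Fin p, lam s < R)
    (μ : Measure (Matrix.unitaryGroup (Fin p) ℂ))
    [μ.IsMulLeftInvariant] [IsProbabilityMeasure μ] :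
    (∏ i : Fin r, ((1 + h i : ℝ) : ℂ) ^ (-(n : ℤ))) *
        ∫ G : Matrix.unitaryGroup (Fin p) ℂ,
          Complex.exp (-(n : ℂ) * Matrix.trace
            ((Matrix.diagonal (fun j : Fin p =>
                if hj : (j : ℕ) < r then (((1 + h ⟨(j : ℕ), hj⟩)⁻¹ : ℝ) : ℂ) else 1) -
              (1 : Matrix (Fin p) (Fin p) ℂ)) *
              (G : Matrix (Fin p) (Fin p) ℂ) *
              Matrix.diagonal (fun s : Fin p => ((lam s : ℝ) : ℂ)) *
              ((G⁻¹ : Matrix.unitaryGroup (Fin p) ℂ) : Matrix (Fin p) (Fin p) ℂ))) ∂μ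
      = ((-1 : ℂ) ^ (r * (r - 1) / 2) *
          (n : ℂ) ^ (-(p * r : ℤ) + ((r * (r + 1) / 2 : ℕ) : ℤ)) *
          (∏ i : Fin r, ∏ j ∈ Finset.univ.filter (· < i), (((h i - h j : ℝ) : ℂ))⁻¹) *
          ∏ t : Fin r,
            (((h t : ℝ) : ℂ) ^ ((r : ℤ) - (p : ℤ)) *
              ((1 + h t : ℝ) : ℂ) ^ ((p : ℤ) - (n : ℤ) - 1) *
              (Nat.factorial (p - 1 - (t : ℕ)) : ℂ))) *
        Matrix.det (Matrix.of fun i j : Fin r =>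
          (2 * Real.pi * Complex.I)⁻¹ *
            ∮ z in C((0 : ℂ), R),
              Complex.exp ((n : ℂ) * (h i : ℝ) * z / ((1 + h i : ℝ) : ℂ)) * z ^ (j : ℕ) *
                ∏ s : Fin p, (z - ((lam s : ℝ) : ℂ))⁻¹) := by
  obtain ⟨k, rfl⟩ := Nat.exists_eq_add_of_le hrp
  have hne : (Finset.univ : Finset (Fin (r + k))).Nonempty := ⟨⟨0, hp⟩, Finset.mem_univ _⟩
  set ρ := Finset.univ.sup' hne lam with hρ
  have hρR : ρ < R := (Finset.sup'_lt_iff hne).2 fun s _ => hR s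
  have hR0 : 0 ≤ R := (hlam ⟨0, hp⟩).trans (hR _).le
  have hlamρ : ∀ s, ‖((lam s : ℝ) : ℂ)‖ ≤ ρ := fun s => by
    rw [Complex.norm_real, Real.norm_of_nonneg (hlam s)]
    exact Finset.le_sup' lam (Finset.mem_univ s)
  have hn0 : (n : ℂ) ≠ 0 := Nat.cast_ne_zero.2 (by lia)
  have hh0 : ∀ i, ((h i : ℝ) : ℂ) ≠ 0 := fun i => Complex.ofReal_ne_zero.2 (hpos i).ne'
  have hH0 : ∀ i, (1 + ((h i : ℝ) : ℂ)) ≠ 0 := fun i => by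
    have := hpos i
    exact_mod_cast (by positivity : (1 + h i : ℝ) ≠ 0)
  have hinj : Function.Injective fun i => ((h i : ℝ) : ℂ) := fun i j hij => by
    by_contra hne
    exact hdist i j hne (Complex.ofReal_injective hij)
  have key := prod_pow_mul_det_vandermonde_mul_integral_exp μ hlamρ hρR hR0 r k rfl
    fun i => (n : ℂ) * (h i : ℝ) / (1 + (h i : ℝ))
  have hexp : ∀ G : Matrix.unitaryGroup (Fin (r + k)) ℂ,
      -(n : ℂ) * Matrix.trace ((Matrix.diagonal (fun j : Fin (r + k) =>
          if hj : (j : ℕ) < r then (((1 + h ⟨(j : ℕ), hj⟩)⁻¹ : ℝ) : ℂ) else 1) -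
        (1 : Matrix (Fin (r + k)) (Fin (r + k)) ℂ)) *
        (G : Matrix (Fin (r + k)) (Fin (r + k)) ℂ) *
        Matrix.diagonal (fun s : Fin (r + k) => ((lam s : ℝ) : ℂ)) *
        ((G⁻¹ : Matrix.unitaryGroup (Fin (r + k)) ℂ) : Matrix (Fin (r + k)) (Fin (r + k)) ℂ)) =
      ∑ i, (n : ℂ) * (h i : ℝ) / (1 + (h i : ℝ)) *
        conjDiag (fun s => ((lam s : ℝ) : ℂ)) (Fin.castLE (by lia) i) G := by
    intro G
    rw [trace_diagonal_sub_one_mul_conj (fun i => (((1 + h i)⁻¹ : ℝ) : ℂ)), Finset.mul_sum]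
    refine Finset.sum_congr rfl fun i _ => ?_
    have := hH0 i
    push_cast
    field_simp
    ring
  have hcirc : ∀ i j : Fin r, (∮ z in C((0 : ℂ), R),
        Complex.exp ((n : ℂ) * (h i : ℝ) * z / ((1 + h i : ℝ) : ℂ)) * z ^ (j : ℕ) *
          ∏ s : Fin (r + k), (z - ((lam s : ℝ) : ℂ))⁻¹) =
      ∮ z in C((0 : ℂ), R), cexp ((n : ℂ) * (h i : ℝ) / (1 + (h i : ℝ)) * z) * (z ^ (j : ℕ) *
        ∏ s : Fin (r + k), (z - ((lam s : ℝ) : ℂ))⁻¹) := by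
    intro i j
    congr 1; funext z
    rw [mul_assoc, Complex.ofReal_add, Complex.ofReal_one, mul_div_right_comm]
  simp only [hexp, hcirc]
  set E := ∫ G, cexp (∑ i, (n : ℂ) * (h i : ℝ) / (1 + (h i : ℝ)) *
        conjDiag (fun s => ((lam s : ℝ) : ℂ)) (Fin.castLE (by lia) i) G) ∂μ
  set D := (Matrix.of fun i j : Fin r => (2 * π * I)⁻¹ * ∮ z in C((0 : ℂ), R),
    cexp ((n : ℂ) * (h i : ℝ) / (1 + (h i : ℝ)) * z) * (z ^ (j : ℕ) *
        ∏ s : Fin (r + k), (z - ((lam s : ℝ) : ℂ))⁻¹)).det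
  rw [Matrix.det_vandermonde_div_one_add _ _ hH0, Finset.prod_mul_distrib, prod_univ_pow_val] at key
  have hV := Matrix.det_vandermonde_ne_zero_iff.2 hinj
  have hdiff : ∏ i : Fin r, ∏ j ∈ Finset.univ.filter (· < i), (((h i - h j : ℝ) : ℂ))⁻¹ =
      (Matrix.vandermonde fun i => ((h i : ℝ) : ℂ)).det⁻¹ := by
    rw [← prod_filter_lt_sub_eq_det_vandermonde]
    simp [Finset.prod_inv_distrib]
  have hpow : (n : ℂ) ^ (-(((r + k : ℕ) : ℤ) * r) + ((r * (r + 1) / 2 : ℕ) : ℤ)) *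
      ((n : ℂ) ^ (k * r) * (n : ℂ) ^ (r * (r - 1) / 2)) = 1 := by
    rw [← zpow_natCast, ← zpow_natCast, ← zpow_add₀ hn0, ← zpow_add₀ hn0]
    have h1 : r * (r + 1) / 2 + r * (r - 1) / 2 = r * r := by
      obtain ⟨q, rfl⟩ : ∃ q, r = q + 1 := ⟨r - 1, by lia⟩
      have e1 := Nat.div_mul_cancel (Nat.even_mul_succ_self (q + 1)).two_dvd
      have e2 := Nat.div_mul_cancel (Nat.even_mul_succ_self q).two_dvd
      rw [Nat.add_sub_cancel, mul_comm (q + 1) q]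
      nlinarith
    rw [← zpow_zero (n : ℂ)]
    congr 1
    have h2 : ((r * (r + 1) / 2 : ℕ) : ℤ) + ((r * (r - 1) / 2 : ℕ) : ℤ) = r * r := by
      exact_mod_cast h1
    push_cast at h2 ⊢
    linear_combination h2
  have hH : (∏ t : Fin r, (((h t : ℝ) : ℂ) ^ ((r : ℤ) - ((r + k : ℕ) : ℤ)) *
        ((1 + h t : ℝ) : ℂ) ^ (((r + k : ℕ) : ℤ) - (n : ℤ) - 1))) *
      ((∏ i, ((n : ℂ) * (h i : ℝ) / (1 + (h i : ℝ))) ^ k) *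
        ∏ i, ((1 + ((h i : ℝ) : ℂ)) ^ (r - 1))⁻¹) =
      (n : ℂ) ^ (k * r) * ∏ i : Fin r, ((1 + h i : ℝ) : ℂ) ^ (-(n : ℤ)) := by
    have hc : (n : ℂ) ^ (k * r) = ∏ _i : Fin r, (n : ℂ) ^ k := by
      rw [Finset.prod_const, Finset.card_univ, Fintype.card_fin, pow_mul]
    rw [hc, ← Finset.prod_mul_distrib, ← Finset.prod_mul_distrib, ← Finset.prod_mul_distrib]
    refine Finset.prod_congr rfl fun i _ => ?_
    have e1 : (r : ℤ) - ((r + k : ℕ) : ℤ) = -(k : ℤ) := by push_cast; ring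
    have e2 : ((r + k : ℕ) : ℤ) - (n : ℤ) - 1 = -(n : ℤ) + (k : ℕ) + (r - 1 : ℕ) := by
      push_cast [hr]
      ring
    have := hH0 i
    have := hh0 i
    rw [e1, e2]
    push_cast
    rw [zpow_add₀ (hH0 i), zpow_add₀ (hH0 i), zpow_natCast, zpow_natCast, _root_.zpow_neg, zpow_natCast,
      div_pow, mul_pow]
    field_simp
  rw [hdiff, Finset.prod_mul_distrib (f := fun t => ((h t : ℝ) : ℂ) ^ ((r : ℤ) - ((r + k : ℕ) : ℤ)) *
        ((1 + h t : ℝ) : ℂ) ^ (((r + k : ℕ) : ℤ) - (n : ℤ) - 1))]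
  have hVi := mul_inv_cancel₀ hV
  generalize (∏ i : Fin r, ((1 + h i : ℝ) : ℂ) ^ (-(n : ℤ))) = P at hH ⊢
  generalize (n : ℂ) ^ (-(((r + k : ℕ) : ℤ) * r) + ((r * (r + 1) / 2 : ℕ) : ℤ)) = N at hpow ⊢
  generalize (∏ t : Fin r, (((h t : ℝ) : ℂ) ^ ((r : ℤ) - ((r + k : ℕ) : ℤ)) *
        ((1 + h t : ℝ) : ℂ) ^ (((r + k : ℕ) : ℤ) - (n : ℤ) - 1))) = Q at hH ⊢
  generalize (∏ i, ((n : ℂ) * (h i : ℝ) / (1 + (h i : ℝ))) ^ k) = A at hH key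
  generalize (∏ i, ((1 + ((h i : ℝ) : ℂ)) ^ (r - 1))⁻¹) = B at hH key
  generalize (n : ℂ) ^ (r * (r - 1) / 2) = M at hpow key
  generalize (Matrix.vandermonde fun i => ((h i : ℝ) : ℂ)).det = V at key hVi ⊢
  linear_combination (-P * E) * hpow - N * M * E * hH + N * V⁻¹ * Q * key -
    N * Q * A * B * M * E * hVi
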